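/- Let 𝒲 be either the free monoid ⟨x⟩_g regarded inside the free group F_g, or the free product Z₂^{*g}, and write G_𝒲 for F_g, respectively Z₂^{*g}. Fix w ∈ 𝒲, positive integers M and K, the group 𝔜 with its generators, and ε > 0. Then there exists a positive integer W ≥ M with the following property: for every M_K(ℂ)-valued trigonometric polynomial A of bidegree at most (w, M) whose coefficient at the identity is the identity matrix I_K and which satisfies ⟨A(π)ξ, ξ⟩ ≥ ε‖ξ‖² for every separable complex Hilbert space F, every unitary representation π of G_𝒲 × 𝔜 on F, and every ξ ∈ F^K, there exist a positive integer K′ and an analytic polynomial B of bidegree at most (w, W) with coefficients in the K′×K complex matrices such that A = B*B, i.e., for every α ∈ G_𝒲 × 𝔜 the coefficient A_α (set equal to 0 when α ∉ Her W_{≤w} × Her 𝒴_{≤M}) equals the sum of B_β* B_γ over all pairs β, γ ∈ W_{≤w} × 𝒴_{≤W} with β⁻¹γ = α. -/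

import Mathlib

open scoped ComplexInnerProductSpace
open Matrix

/-- The strict shortlex order on words over the alphabet `Fin n`. -/
def ShortlexLT {n : ℕ} (a b : List (Fin n)) : Prop :=
  a.length < b.length ∨ (a.length = b.length ∧ List.Lex (· < ·) a b)

/-- The shortlex order on words over the alphabet `Fin n`. -/
def ShortlexLE {n : ℕ} (a b : List (Fin n)) : Prop :=
  ShortlexLT a b ∨ a = b

/-- The image of a word in the free group. -/
def wordF {g : ℕ} (l : List (Fin g)) : FreeGroup (Fin g) :=
  (l.map FreeGroup.of).prod

/-- `W_{≤ w}`: the image in the free group of the set of words `≤ w` in shortlex. -/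
def WleF {g : ℕ} (w : List (Fin g)) : Set (FreeGroup (Fin g)) :=
  {a | ∃ l : List (Fin g), ShortlexLE l w ∧ wordF l = a}

/-- `Her W_{≤ w} = {u⁻¹ v : u, v ∈ W_{≤ w}}`. -/
def HerWleF {g : ℕ} (w : List (Fin g)) : Set (FreeGroup (Fin g)) :=
  {α | ∃ u ∈ WleF w, ∃ v ∈ WleF w, u⁻¹ * v = α}

/-- The relations `x_i² = e` presenting the free product of `g` copies of `ℤ/2`. -/
def z2Rels (g : ℕ) : Set (FreeGroup (Fin g)) :=
  {r | ∃ i : Fin g, r = FreeGroup.of i * FreeGroup.of i}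

/-- The free product `ℤ₂^{*g}` of `g` copies of the cyclic group of order two. -/
abbrev Z2Star (g : ℕ) := PresentedGroup (z2Rels g)

/-- The canonical generators of `ℤ₂^{*g}`. -/
def z2of {g : ℕ} (i : Fin g) : Z2Star g := PresentedGroup.of (rels := z2Rels g) i

/-- The element of `ℤ₂^{*g}` given by a word in the generators. -/
def wordZ {g : ℕ} (l : List (Fin g)) : Z2Star g := (l.map z2of).prod

/-- The shortlex order on `ℤ₂^{*g}`, via reduced words. -/
def Z2ShortlexLE {g : ℕ} (a b : Z2Star g) : Prop :=
  ∃ la lb : List (Fin g), List.Chain' (· ≠ ·) la ∧ List.Chain' (· ≠ ·) lb ∧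
    wordZ la = a ∧ wordZ lb = b ∧ ShortlexLE la lb

/-- `W_{≤ w}` in `ℤ₂^{*g}`. -/
def WleZ {g : ℕ} (w : Z2Star g) : Set (Z2Star g) := {v | Z2ShortlexLE v w}

/-- `Her W_{≤ w}` in `ℤ₂^{*g}`. -/
def HerWleZ {g : ℕ} (w : Z2Star g) : Set (Z2Star g) :=
  {α | ∃ u ∈ WleZ w, ∃ v ∈ WleZ w, u⁻¹ * v = α}

/-- `𝒴_{≤ M}`: products of at most `M` of the generators `y`. -/
def Yle {h : ℕ} {Y : Type*} [Group Y] (y : Fin h → Y) (M : ℕ) : Set Y :=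
  {a | ∃ l : List (Fin h), l.length ≤ M ∧ (l.map y).prod = a}

/-- `Her 𝒴_{≤ M}`. -/
def HerYle {h : ℕ} {Y : Type*} [Group Y] (y : Fin h → Y) (M : ℕ) : Set Y :=
  {η | ∃ a ∈ Yle y M, ∃ b ∈ Yle y M, a⁻¹ * b = η}

/-- A scalar kernel is positive if it is Hermitian and its quadratic form on finitely supported
vectors is nonnegative. -/
def IsPosKernel {I : Type*} (κ : I → I → ℂ) : Prop :=
  (∀ i j, star (κ i j) = κ j i) ∧
    ∀ x : I →₀ ℂ, 0 ≤ (x.sum fun i a => x.sum fun j b => star a * b * κ i j).re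

theorem isPosKernel_gram {I H : Type*} [NormedAddCommGroup H] [InnerProductSpace ℂ H]
    (v : I → H) : IsPosKernel fun i j => ⟪v i, v j⟫ := by
  refine ⟨fun i j => inner_conj_symm _ _, fun x => ?_⟩
  have h : (x.sum fun i a => x.sum fun j b => star a * b * ⟪v i, v j⟫) =
      ⟪x.sum fun i a => a • v i, x.sum fun i a => a • v i⟫ := by
    rw [Finsupp.sum_inner]
    refine Finsupp.sum_congr fun i _ => ?_
    rw [Finsupp.inner_sum]
    simp [Finsupp.sum, inner_smul_left, inner_smul_right, mul_comm, mul_left_comm]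
  rw [h]
  exact inner_self_nonneg (𝕜 := ℂ)

/-- Every positive kernel is the Gram kernel of a family with dense span in a Hilbert space. -/
theorem IsPosKernel.exists_gram {I : Type} {κ : I → I → ℂ} (hκ : IsPosKernel κ) :
    ∃ (H : Type) (_ : NormedAddCommGroup H) (_ : InnerProductSpace ℂ H) (_ : CompleteSpace H)
      (e : I → H), (∀ i j, ⟪e i, e j⟫ = κ i j) ∧ DenseRange (Finsupp.linearCombination ℂ e) := by
  let c : PreInnerProductSpace.Core ℂ (I →₀ ℂ) :=
    { inner := fun f g => f.sum fun i a => g.sum fun j b => star a * b * κ i j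
      conj_inner_symm := fun f g => by
        rw [Finsupp.sum_comm]
        simp only [map_finsuppSum]
        refine Finsupp.sum_congr fun i _ => Finsupp.sum_congr fun j _ => ?_
        rw [← hκ.1 j i]
        simp [mul_comm]
      re_inner_nonneg := hκ.2
      add_left := fun _ _ _ => by
        rw [Finsupp.sum_add_index'] <;> simp [← Finsupp.sum_add, add_mul]
      smul_left := fun _ _ _ => by
        rw [Finsupp.sum_smul_index] <;> simp [Finsupp.mul_sum, ← mul_assoc] }
  let : SeminormedAddCommGroup (I →₀ ℂ) :=
    InnerProductSpace.Core.toSeminormedAddCommGroup (𝕜 := ℂ)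
  let : InnerProductSpace ℂ (I →₀ ℂ) := .ofCore _
  refine ⟨UniformSpace.Completion (I →₀ ℂ), inferInstance, inferInstance, inferInstance,
    fun i => ((Finsupp.single i 1 : I →₀ ℂ) : UniformSpace.Completion (I →₀ ℂ)), ?_, ?_⟩
  · intro i j
    rw [UniformSpace.Completion.inner_coe]
    change Finsupp.sum _ _ = _
    simp
  · have h : ∀ x : I →₀ ℂ, Finsupp.linearCombination ℂ
        (fun i => ((Finsupp.single i 1 : I →₀ ℂ) : UniformSpace.Completion (I →₀ ℂ))) x
        = (x : UniformSpace.Completion (I →₀ ℂ)) := by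
      intro x
      have h2 : Finsupp.linearCombination ℂ
        (fun i => ((Finsupp.single i 1 : I →₀ ℂ) : UniformSpace.Completion (I →₀ ℂ))) =
        (UniformSpace.Completion.toComplL (𝕜 := ℂ) (E := I →₀ ℂ)).toLinearMap := by
        ext i
        simp
      rw [h2]; rfl
    have h3 : (⇑(Finsupp.linearCombination ℂ
        (fun i => ((Finsupp.single i 1 : I →₀ ℂ) : UniformSpace.Completion (I →₀ ℂ))))) =
        ((↑) : (I →₀ ℂ) → UniformSpace.Completion (I →₀ ℂ)) := funext h
    rw [h3]
    exact UniformSpace.Completion.denseRange_coe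

section Gram

variable {I H H' : Type*} [NormedAddCommGroup H] [InnerProductSpace ℂ H]
  [NormedAddCommGroup H'] [InnerProductSpace ℂ H'] {e : I → H}

theorem continuousLinearMap_eq_of_eq_on (he : DenseRange (Finsupp.linearCombination ℂ e))
    {S T : H →L[ℂ] H'} (h : ∀ i, S (e i) = T (e i)) : S = T := by
  apply DFunLike.coe_injective
  refine he.equalizer S.continuous T.continuous (funext fun x => ?_)
  simp [Finsupp.linearCombination_apply, map_finsuppSum, h]

theorem norm_linearCombination_eq {v : I → H'} (h : ∀ i j, ⟪v i, v j⟫ = ⟪e i, e j⟫) (x : I →₀ ℂ) :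
    ‖Finsupp.linearCombination ℂ v x‖ = ‖Finsupp.linearCombination ℂ e x‖ := by
  have h2 : ⟪Finsupp.linearCombination ℂ v x, Finsupp.linearCombination ℂ v x⟫ =
      ⟪Finsupp.linearCombination ℂ e x, Finsupp.linearCombination ℂ e x⟫ := by
    simp only [Finsupp.linearCombination_apply, Finsupp.sum_inner, Finsupp.inner_sum,
      inner_smul_left,
      inner_smul_right, h]
  rw [inner_self_eq_norm_sq_to_K, inner_self_eq_norm_sq_to_K] at h2
  have h3 : ‖Finsupp.linearCombination ℂ v x‖ ^ 2 = ‖Finsupp.linearCombination ℂ e x‖ ^ 2 := by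
    exact_mod_cast h2
  exact (sq_eq_sq₀ (norm_nonneg _) (norm_nonneg _)).1 h3

theorem exists_linearIsometry [CompleteSpace H']
    (he : DenseRange (Finsupp.linearCombination ℂ e)) {v : I → H'}
    (h : ∀ i j, ⟪v i, v j⟫ = ⟪e i, e j⟫) : ∃ V : H →ₗᵢ[ℂ] H', ∀ i, V (e i) = v i := by
  have hn := norm_linearCombination_eq h
  have hC : ∃ C, ∀ x, ‖Finsupp.linearCombination ℂ v x‖ ≤ C * ‖Finsupp.linearCombination ℂ e x‖ :=
    ⟨1, fun x => by rw [one_mul, hn]⟩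
  set T := (Finsupp.linearCombination ℂ v).extendOfNorm (Finsupp.linearCombination ℂ e) with hT
  have hTe := LinearMap.extendOfNorm_eq he hC
  refine ⟨⟨T.toLinearMap, fun x => ?_⟩, fun i => ?_⟩
  · refine congrFun (DenseRange.equalizer (g := fun x => ‖T x‖) (h := fun x => ‖x‖) he
      (by fun_prop) (by fun_prop) (funext fun y => ?_)) x
    simp only [Function.comp]
    rw [hTe, hn]
  · simpa using hTe (Finsupp.single i 1)

end Gram

section Halmos

variable {H : Type*} [NormedAddCommGroup H] [InnerProductSpace ℂ H]

theorem separableSpace_of_denseRange {I : Type*} [Countable I] {e : I → H}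
    (he : DenseRange (Finsupp.linearCombination ℂ e)) : TopologicalSpace.SeparableSpace H := by
  have h : TopologicalSpace.IsSeparable (Submodule.span ℂ (Set.range e) : Set H) :=
    (Set.countable_range e).isSeparable.span
  rw [← TopologicalSpace.isSeparable_univ_iff, ← he.closure_range]
  have h2 := Finsupp.range_linearCombination ℂ (v := e)
  rw [← h2] at h
  exact h.closure

/-- A linear map with an everywhere defined formal adjoint inverse is unitary. -/
theorem exists_linearIsometryEquiv_of_adjoint (T T' : H →ₗ[ℂ] H)
    (hadj : ∀ x y, ⟪T x, y⟫ = ⟪x, T' y⟫) (h1 : ∀ x, T (T' x) = x) (h2 : ∀ x, T' (T x) = x) :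
    ∃ U : H ≃ₗᵢ[ℂ] H, ∀ x, U x = T x := by
  refine ⟨⟨LinearEquiv.ofLinearMap T T' (LinearMap.ext h1) (LinearMap.ext h2), fun x => ?_⟩,
    fun x => rfl⟩
  have h3 : ⟪T x, T x⟫ = ⟪x, x⟫ := by rw [hadj, h2]
  rw [inner_self_eq_norm_sq_to_K, inner_self_eq_norm_sq_to_K] at h3
  have h4 : ‖T x‖ ^ 2 = ‖x‖ ^ 2 := by exact_mod_cast h3
  exact (sq_eq_sq₀ (norm_nonneg _) (norm_nonneg _)).1 h4

/-- The Halmos block operator with entries `V`, `1 - V V'`, `1 - V' V`, `V'`. -/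
noncomputable def halmos (V V' : H →ₗ[ℂ] H) : WithLp 2 (H × H) →ₗ[ℂ] WithLp 2 (H × H) where
  toFun x := WithLp.toLp 2 (V x.fst + (x.snd - V (V' x.snd)), (x.fst - V' (V x.fst)) + V' x.snd)
  map_add' x y := by
    apply WithLp.ofLp_injective
    ext <;> simp <;> abel
  map_smul' c x := by
    apply WithLp.ofLp_injective
    ext <;> simp [smul_add, smul_sub]

theorem exists_halmos_dilation [CompleteSpace H] (V V' : H →ₗ[ℂ] H)
    (hadj : ∀ x y, ⟪V x, y⟫ = ⟪x, V' y⟫)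
    (h1 : ∀ x, V (V' (V x)) = V x) (h2 : ∀ x, V' (V (V' x)) = V' x) :
    ∃ U : WithLp 2 (H × H) ≃ₗᵢ[ℂ] WithLp 2 (H × H), ∀ x, U x = halmos V V' x := by
  have hadj' : ∀ x y, ⟪V' x, y⟫ = ⟪x, V y⟫ := fun x y => by
    rw [← inner_conj_symm, ← hadj, inner_conj_symm]
  let T' : WithLp 2 (H × H) →ₗ[ℂ] WithLp 2 (H × H) :=
    { toFun := fun x => WithLp.toLp 2
        (V' x.fst + (x.snd - V' (V x.snd)), (x.fst - V (V' x.fst)) + V x.snd)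
      map_add' := fun x y => by
        apply WithLp.ofLp_injective
        ext <;> simp <;> abel
      map_smul' := fun c x => by
        apply WithLp.ofLp_injective
        ext <;> simp [smul_add, smul_sub] }
  refine exists_linearIsometryEquiv_of_adjoint (halmos V V') T' ?_ ?_ ?_
  · intro x y
    simp only [halmos, T', LinearMap.coe_mk, AddHom.coe_mk, WithLp.prod_inner_apply,
      inner_add_left, inner_add_right, inner_sub_left, inner_sub_right, hadj, hadj',
      WithLp.ofLp_fst,
      WithLp.ofLp_snd]
    ring
  · intro x
    apply WithLp.ofLp_injective
    ext <;> simp [halmos, T', h1, h2]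
  · intro x
    apply WithLp.ofLp_injective
    ext <;> simp [halmos, T', h1, h2]

end Halmos

section Dilation

/-- A group acting on the index set of a dense family and preserving its Gram kernel acts
unitarily. -/
theorem exists_unitaryRep {I H Y : Type*} [Group Y] [NormedAddCommGroup H] [InnerProductSpace ℂ H]
    [CompleteSpace H] {e : I → H} (he : DenseRange (Finsupp.linearCombination ℂ e))
    (act : Y → I → I) (hact1 : ∀ i, act 1 i = i)
    (hactmul : ∀ η ζ i, act (η * ζ) i = act η (act ζ i))
    (hinv : ∀ η i j, ⟪e (act η i), e (act η j)⟫ = ⟪e i, e j⟫) :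
    ∃ ρ : Y →* (H ≃ₗᵢ[ℂ] H), ∀ η i, ρ η (e i) = e (act η i) := by
  choose W hW using fun η => exists_linearIsometry he (v := fun i => e (act η i)) (hinv η)
  have h1 : ∀ x, W 1 x = x := fun x => by
    have := continuousLinearMap_eq_of_eq_on he (S := (W 1).toContinuousLinearMap)
      (T := ContinuousLinearMap.id ℂ H) (fun i => by simp [hW, hact1])
    exact congrArg (fun T : H →L[ℂ] H => T x) this
  have hmul : ∀ η ζ x, W (η * ζ) x = W η (W ζ x) := fun η ζ x => by
    have := continuousLinearMap_eq_of_eq_on he (S := (W (η * ζ)).toContinuousLinearMap)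
      (T := (W η).toContinuousLinearMap.comp (W ζ).toContinuousLinearMap)
      (fun i => by simp [hW, hactmul])
    exact congrArg (fun T : H →L[ℂ] H => T x) this
  refine ⟨⟨⟨fun η => ⟨LinearEquiv.ofLinearMap (W η).toLinearMap (W η⁻¹).toLinearMap
    (LinearMap.ext fun x => ?_) (LinearMap.ext fun x => ?_), fun x => (W η).norm_map x⟩, ?_⟩, ?_⟩,
    hW⟩
  · change W η (W η⁻¹ x) = x
    rw [← hmul, mul_inv_cancel, h1]
  · change W η⁻¹ (W η x) = x
    rw [← hmul, inv_mul_cancel, h1]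
  · ext x
    exact h1 x
  · intro η ζ
    ext x
    exact hmul η ζ x

theorem unitary_mul_apply {H : Type*} [NormedAddCommGroup H] [InnerProductSpace ℂ H]
    (a b : H ≃ₗᵢ[ℂ] H) (x : H) : (a * b) x = a (b x) := rfl

theorem inner_unitaryRep_left {H Y : Type*} [Group Y] [NormedAddCommGroup H]
    [InnerProductSpace ℂ H] (ρ : Y →* (H ≃ₗᵢ[ℂ] H)) (η : Y) (x y : H) :
    ⟪ρ η x, y⟫ = ⟪x, ρ η⁻¹ y⟫ := by
  rw [← (ρ η⁻¹).inner_map_map, ← unitary_mul_apply, ← map_mul, inv_mul_cancel, map_one]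
  rfl

/-- A unitary representation acts diagonally on the doubled space. -/
theorem exists_unitaryRep_double {H Y : Type*} [Group Y] [NormedAddCommGroup H]
    [InnerProductSpace ℂ H] (ρ : Y →* (H ≃ₗᵢ[ℂ] H)) :
    ∃ R : Y →* (WithLp 2 (H × H) ≃ₗᵢ[ℂ] WithLp 2 (H × H)),
      ∀ η x, R η x = WithLp.toLp 2 (ρ η x.fst, ρ η x.snd) := by
  have hc : ∀ η x, ρ η (ρ η⁻¹ x) = x := fun η x => by
    rw [← unitary_mul_apply, ← map_mul, mul_inv_cancel, map_one]
    rfl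
  have hc' : ∀ η x, ρ η⁻¹ (ρ η x) = x := fun η x => by
    rw [← unitary_mul_apply, ← map_mul, inv_mul_cancel, map_one]
    rfl
  have h : ∀ η, ∃ T : WithLp 2 (H × H) ≃ₗᵢ[ℂ] WithLp 2 (H × H),
      ∀ x, T x = WithLp.toLp 2 (ρ η x.fst, ρ η x.snd) := by
    intro η
    let T : Y → WithLp 2 (H × H) →ₗ[ℂ] WithLp 2 (H × H) := fun η =>
      { toFun := fun x => WithLp.toLp 2 (ρ η x.fst, ρ η x.snd)
        map_add' := fun x y => by apply WithLp.ofLp_injective; ext <;> simp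
        map_smul' := fun c x => by apply WithLp.ofLp_injective; ext <;> simp }
    refine exists_linearIsometryEquiv_of_adjoint (T η) (T η⁻¹) ?_ ?_ ?_
    · intro x y
      simp only [T, WithLp.prod_inner_apply, LinearMap.coe_mk, AddHom.coe_mk,
        inner_unitaryRep_left, WithLp.ofLp_fst, WithLp.ofLp_snd]
    · intro x
      apply WithLp.ofLp_injective
      exact Prod.ext (hc η _) (hc η _)
    · intro x
      apply WithLp.ofLp_injective
      exact Prod.ext (hc' η _) (hc' η _)
  choose T hT using h
  refine ⟨⟨⟨T, ?_⟩, ?_⟩, hT⟩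
  · apply LinearIsometryEquiv.ext
    intro x
    rw [hT, map_one]
    rfl
  · intro η ζ
    apply LinearIsometryEquiv.ext
    intro x
    change T (η * ζ) x = T η (T ζ x)
    rw [hT, hT, hT, map_mul]
    rfl

/-- Left translation by `t` is a partial isometry commuting with the unitaries of `Y`. -/
theorem exists_partialIsometry {G Y k H : Type} [Group G] [Group Y] [NormedAddCommGroup H]
    [InnerProductSpace ℂ H] [CompleteSpace H] (S : Set G) (φ : G × Y → k → k → ℂ)
    (e : (S × Y) × k → H)
    (hφ : ∀ a b, ⟪e a, e b⟫ = φ ((a.1.1 : G)⁻¹ * b.1.1, a.1.2⁻¹ * b.1.2) a.2 b.2)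
    (ρ : Y →* (H ≃ₗᵢ[ℂ] H)) (hρ : ∀ η a, ρ η (e a) = e ((a.1.1, η * a.1.2), a.2)) (t : G) :
    ∃ V V' : H →L[ℂ] H, (∀ x y, ⟪V x, y⟫ = ⟪x, V' y⟫) ∧
      (∀ x, V (V' (V x)) = V x) ∧ (∀ x, V' (V (V' x)) = V' x) ∧
      (∀ η x, V (ρ η x) = ρ η (V x)) ∧ (∀ η x, V' (ρ η x) = ρ η (V' x)) ∧
      (∀ (u v : S), (v : G) = t * u → ∀ η i, V (e ((u, η), i)) = e ((v, η), i)) ∧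
      (∀ (u v : S), (v : G) = t * u → ∀ η i, V' (e ((v, η), i)) = e ((u, η), i)) ∧
      (t * t = 1 → V = V') := by
  let D : Type := {u : G // u ∈ S ∧ t * u ∈ S}
  let f₁ : (D × Y) × k → (S × Y) × k := fun a => ((⟨a.1.1.1, a.1.1.2.1⟩, a.1.2), a.2)
  let f₂ : (D × Y) × k → (S × Y) × k := fun a => ((⟨t * a.1.1.1, a.1.1.2.2⟩, a.1.2), a.2)
  obtain ⟨E, _, _, _, d, hd, hdense⟩ := (isPosKernel_gram (fun a => e (f₁ a))).exists_gram
  have hd2 : ∀ a b, ⟪e (f₂ a), e (f₂ b)⟫ = ⟪d a, d b⟫ := fun a b => by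
    rw [hd, hφ, hφ]
    simp [f₁, f₂, mul_assoc]
  obtain ⟨ι₁, hι₁⟩ := exists_linearIsometry hdense (v := fun a => e (f₁ a)) fun a b => (hd a b).symm
  obtain ⟨ι₂, hι₂⟩ := exists_linearIsometry hdense (v := fun a => e (f₂ a)) hd2
  obtain ⟨σ, hσ⟩ := exists_unitaryRep (Y := Y) hdense
    (fun η a => ((a.1.1, η * a.1.2), a.2)) (by simp) (by simp [mul_assoc])
    (fun η a b => by rw [hd, hd, hφ, hφ]; simp [f₁, mul_assoc])
  have hc : ∀ (ι : E →ₗᵢ[ℂ] H) (f : (D × Y) × k → (S × Y) × k), (∀ a, ι (d a) = e (f a)) →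
      (∀ η a, f ((a.1.1, η * a.1.2), a.2) = (((f a).1.1, η * (f a).1.2), (f a).2)) →
      ∀ η x, ι (σ η x) = ρ η (ι x) := by
    intro ι f hι hf η x
    have := continuousLinearMap_eq_of_eq_on hdense
      (S := ι.toContinuousLinearMap.comp (σ η).toContinuousLinearEquiv.toContinuousLinearMap)
      (T := (ρ η).toContinuousLinearEquiv.toContinuousLinearMap.comp ι.toContinuousLinearMap)
      (fun a => by simp [hσ, hρ, hι, hf])
    exact congrArg (fun T : E →L[ℂ] H => T x) this
  have hc₁ := hc ι₁ f₁ hι₁ fun _ _ => rfl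
  have hc₂ := hc ι₂ f₂ hι₂ fun _ _ => rfl
  have hadj : ∀ ι : E →ₗᵢ[ℂ] H, (∀ η x, ι (σ η x) = ρ η (ι x)) →
      ∀ η x, ι.toContinuousLinearMap.adjoint (ρ η x) =
        σ η (ι.toContinuousLinearMap.adjoint x) := by
    intro ι hι η x
    refine ext_inner_left ℂ fun y => ?_
    rw [ContinuousLinearMap.adjoint_inner_right]
    have h1 : ⟪y, σ η (ι.toContinuousLinearMap.adjoint x)⟫ =
        ⟪σ η⁻¹ y, ι.toContinuousLinearMap.adjoint x⟫ := by
      rw [inner_unitaryRep_left, inv_inv]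
    rw [h1, ContinuousLinearMap.adjoint_inner_right]
    change ⟪ι y, _⟫ = ⟪ι (σ η⁻¹ y), _⟫
    rw [hι, inner_unitaryRep_left, inv_inv]
  have hiso : ∀ (ι : E →ₗᵢ[ℂ] H) x, ι.toContinuousLinearMap.adjoint (ι x) = x := by
    intro ι x
    refine ext_inner_left ℂ fun y => ?_
    rw [ContinuousLinearMap.adjoint_inner_right]
    simp
  refine ⟨ι₂.toContinuousLinearMap.comp ι₁.toContinuousLinearMap.adjoint,
    ι₁.toContinuousLinearMap.comp ι₂.toContinuousLinearMap.adjoint, ?_, ?_, ?_, ?_, ?_, ?_, ?_, ?_⟩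
  · intro x y
    have h := ContinuousLinearMap.adjoint_inner_right ι₂.toContinuousLinearMap
      (ι₁.toContinuousLinearMap.adjoint x) y
    have h' := ContinuousLinearMap.adjoint_inner_left ι₁.toContinuousLinearMap
      (ι₂.toContinuousLinearMap.adjoint y) x
    simp only [ContinuousLinearMap.comp_apply]
    rw [← h, h']
  · intro x
    simp [hiso]
  · intro x
    simp [hiso]
  · intro η x
    simp [hadj ι₁ hc₁, hc₂]
  · intro η x
    simp [hadj ι₂ hc₂, hc₁]
  · intro u v huv η i
    have h1 : e ((u, η), i) = ι₁ (d ((⟨u, u.2, huv ▸ v.2⟩, η), i)) := by rw [hι₁]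
    rw [ContinuousLinearMap.comp_apply, h1, hiso]
    simp only [LinearIsometry.coe_toContinuousLinearMap, hι₂, f₂]
    congr 3
    exact Subtype.ext huv.symm
  · intro u v huv η i
    have h1 : e ((v, η), i) = ι₂ (d ((⟨u, u.2, huv ▸ v.2⟩, η), i)) := by
      rw [hι₂]
      simp only [f₂]
      congr 3
      exact Subtype.ext huv
    rw [ContinuousLinearMap.comp_apply, h1, hiso]
    simp only [LinearIsometry.coe_toContinuousLinearMap, hι₁, f₁]
  · intro ht
    let sw : (D × Y) × k → (D × Y) × k := fun a =>
      ((⟨t * a.1.1.1, a.1.1.2.2, by rw [← mul_assoc, ht, one_mul]; exact a.1.1.2.1⟩, a.1.2), a.2)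
    obtain ⟨τ, hτ⟩ := exists_linearIsometry hdense (v := fun a => d (sw a)) fun a b => by
      rw [hd, ← hd2]
    have h21 : ∀ x, ι₂ x = ι₁ (τ x) := fun x => by
      have := continuousLinearMap_eq_of_eq_on hdense (S := ι₂.toContinuousLinearMap)
        (T := ι₁.toContinuousLinearMap.comp τ.toContinuousLinearMap)
        (fun a => by simp [hι₁, hι₂, hτ, sw, f₁, f₂])
      exact congrArg (fun T : E →L[ℂ] H => T x) this
    have h12 : ∀ x, ι₁ x = ι₂ (τ x) := fun x => by
      have := continuousLinearMap_eq_of_eq_on hdense (S := ι₁.toContinuousLinearMap)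
        (T := ι₂.toContinuousLinearMap.comp τ.toContinuousLinearMap)
        (fun a => by simp [hι₁, hι₂, hτ, sw, f₁, f₂, ← mul_assoc, ht])
      exact congrArg (fun T : E →L[ℂ] H => T x) this
    ext x
    simp only [ContinuousLinearMap.comp_apply, LinearIsometry.coe_toContinuousLinearMap]
    rw [h21]
    congr 1
    refine ext_inner_left ℂ fun y => ?_
    rw [ContinuousLinearMap.adjoint_inner_right]
    have hττ : ∀ z, τ (τ z) = z := fun z => ι₁.injective (by rw [← h21, ← h12])
    have h3 : ⟪y, τ (ι₁.toContinuousLinearMap.adjoint x)⟫ =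
        ⟪τ y, ι₁.toContinuousLinearMap.adjoint x⟫ := by
      rw [← τ.inner_map_map, hττ]
    rw [h3, ContinuousLinearMap.adjoint_inner_right]
    simp [h21]

/-- A positive definite function on `S⁻¹ S × Y`, with `S` reachable from `1` by left multiplication
by the generators `s`, is given by a unitary representation of `G × Y`. -/
theorem exists_unitary_dilation {G Y J k : Type} [Group G] [Group Y] [Countable Y] [Countable k]
    (s : J → G) (S : Set G) [Countable S] (inv : Prop)
    (hlift : ∀ (L : Type) [Group L] (U : J → L), (inv → ∀ j, U j * U j = 1) →
      ∃ ρ : G →* L, ∀ j, ρ (s j) = U j)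
    (hinv : inv → ∀ j, s j * s j = 1)
    (hS : ∀ u ∈ S, ∃ l : List J, (l.map s).prod = u ∧ ∀ l', l' <:+ l → (l'.map s).prod ∈ S)
    (φ : G × Y → k → k → ℂ)
    (hφ : IsPosKernel fun a b : (S × Y) × k =>
      φ ((a.1.1 : G)⁻¹ * b.1.1, a.1.2⁻¹ * b.1.2) a.2 b.2) :
    ∃ (F : Type) (_ : NormedAddCommGroup F) (_ : InnerProductSpace ℂ F) (_ : CompleteSpace F)
      (_ : TopologicalSpace.SeparableSpace F) (π : G × Y →* (F ≃ₗᵢ[ℂ] F)) (ξ : k → F),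
      ∀ u ∈ S, ∀ v ∈ S, ∀ η i j, ⟪ξ i, π (u⁻¹ * v, η) (ξ j)⟫ = φ (u⁻¹ * v, η) i j := by
  by_cases hone : (1 : G) ∈ S
  swap
  · refine ⟨PUnit, inferInstance, inferInstance, inferInstance, inferInstance, 1, 0, ?_⟩
    intro u hu
    obtain ⟨l, -, hl⟩ := hS u hu
    exact absurd (by simpa using hl [] l.nil_suffix) hone
  obtain ⟨H, _, _, _, e, he, hdense⟩ := hφ.exists_gram
  obtain ⟨ρ, hρ⟩ := exists_unitaryRep (Y := Y) hdense
    (fun η a => ((a.1.1, η * a.1.2), a.2)) (by simp) (by simp [mul_assoc])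
    (fun η a b => by rw [he, he]; simp [mul_assoc])
  have hsep := separableSpace_of_denseRange hdense
  choose V V' hadj hV hV' hρV hρV' hVe hVe' hVinv using fun j =>
    exists_partialIsometry S φ e he ρ hρ (s j)
  choose U hU using fun j => exists_halmos_dilation (V j).toLinearMap (V' j).toLinearMap (hadj j)
    (hV j) (hV' j)
  obtain ⟨R, hR⟩ := exists_unitaryRep_double ρ
  let Z := Subgroup.centralizer (Set.range R)
  have hUZ : ∀ j, U j ∈ Z := by
    intro j
    rw [Subgroup.mem_centralizer_iff]
    rintro _ ⟨η, rfl⟩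
    apply LinearIsometryEquiv.ext
    intro x
    apply WithLp.ofLp_injective
    simp only [unitary_mul_apply, hU, hR, halmos]
    ext <;> simp [hρV, hρV']
  obtain ⟨P, hP⟩ := hlift Z (fun j => ⟨U j, hUZ j⟩) fun hi j => by
    ext x
    have hVV := hVinv j (hinv hi j)
    have hVV' : ∀ x, V j (V j (V j x)) = V j x := by
      have := hV j
      rwa [← hVV] at this
    apply WithLp.ofLp_injective
    simp only [MulMemClass.mk_mul_mk, unitary_mul_apply, hU, halmos, ← hVV,
      OneMemClass.coe_one]
    ext <;> simp [hVV']
  let π : G × Y →* (WithLp 2 (H × H) ≃ₗᵢ[ℂ] WithLp 2 (H × H)) :=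
    MonoidHom.noncommCoprod (Z.subtype.comp P) R fun x η =>
    ((Subgroup.mem_centralizer_iff.1 (P x).2) _ ⟨η, rfl⟩).symm
  let ξ : k → WithLp 2 (H × H) := fun i => WithLp.toLp 2 (e ((⟨1, hone⟩, 1), i), 0)
  have hπ : ∀ (l : List J), (∀ l', l' <:+ l → (l'.map s).prod ∈ S) → ∀ (u : S),
      (l.map s).prod = u → ∀ η i, π (u, η) (ξ i) = WithLp.toLp 2 (e ((u, η), i), 0) := by
    intro l
    induction l with
    | nil =>
      intro _ u hu η i
      have hu1 : u = ⟨1, hone⟩ := Subtype.ext (by simpa using hu.symm)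
      subst hu1
      have h : π (1, η) = R η := by
        change (Z.subtype.comp P) 1 * R η = R η
        rw [map_one, one_mul]
      rw [h, hR]
      have h0 : ρ η (e ((⟨1, hone⟩, 1), i)) = e ((⟨1, hone⟩, η), i) := by simp [hρ]
      exact congrArg (WithLp.toLp 2) (Prod.ext h0 (map_zero (ρ η)))
    | cons j l ih =>
      intro hl u hu η i
      have hl' : ∀ l', l' <:+ l → (l'.map s).prod ∈ S := fun l' h =>
        hl l' (h.trans (l.suffix_cons j))
      have hv := hl' l l.suffix_refl
      have h := ih hl' ⟨_, hv⟩ rfl η i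
      have hu' : (u : G) = s j * (l.map s).prod := by rw [← hu]; simp
      have h2 : ((u : G), η) = (s j, 1) * ((l.map s).prod, η) := by simp [hu']
      rw [h2, map_mul, unitary_mul_apply, h]
      have h3 : π (s j, 1) = U j := by
        change (Z.subtype.comp P) (s j) * R 1 = U j
        rw [map_one, mul_one, MonoidHom.comp_apply, hP]
        rfl
      rw [h3, hU]
      have h4 := hVe j ⟨_, hv⟩ u hu' η i
      have h5 := hVe' j ⟨_, hv⟩ u hu' η i
      apply WithLp.ofLp_injective
      simp [halmos, h4, h5]
  refine ⟨WithLp 2 (H × H), inferInstance, inferInstance, inferInstance, ?_, π, ξ, ?_⟩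
  · exact (WithLp.toLp_surjective 2).denseRange.separableSpace (WithLp.prod_continuous_toLp 2 H H)
  · intro u hu v hv η i j
    obtain ⟨l, hl, hl'⟩ := hS u hu
    obtain ⟨m, hm, hm'⟩ := hS v hv
    have h1 := hπ l hl' ⟨u, hu⟩ hl 1 i
    have h2 := hπ m hm' ⟨v, hv⟩ hm η j
    have h3 : ((u⁻¹ * v, η) : G × Y) = (u, 1)⁻¹ * (v, η) := by simp
    rw [h3, map_mul, unitary_mul_apply]
    rw [← inner_unitaryRep_left π, h1, h2]
    simp [WithLp.prod_inner_apply, he]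

end Dilation

section Coefficients

theorem isPosKernel_single {I : Type*} [DecidableEq I] :
    IsPosKernel fun i j : I => if i = j then (1 : ℂ) else 0 := by
  refine ⟨fun i j => ?_, fun x => ?_⟩
  · by_cases h : i = j <;> simp [h, eq_comm]
  · have h : ∀ i, (∑ j ∈ x.support, star (x i) * x j * if i = j then (1 : ℂ) else 0) =
        (Complex.normSq (x i) : ℂ) := by
      intro i
      simp +contextual [Complex.normSq_eq_conj_mul_self]
    simp only [Finsupp.sum, h, Complex.re_sum, Complex.ofReal_re]
    exact Finset.sum_nonneg fun i _ => Complex.normSq_nonneg _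

theorem exists_regularRep (Γ : Type) [Group Γ] [Countable Γ] [DecidableEq Γ] :
    ∃ (F : Type) (_ : NormedAddCommGroup F) (_ : InnerProductSpace ℂ F) (_ : CompleteSpace F)
      (_ : TopologicalSpace.SeparableSpace F) (π : Γ →* (F ≃ₗᵢ[ℂ] F)) (e : Γ → F),
      (∀ a b, ⟪e a, e b⟫ = if a = b then 1 else 0) ∧ ∀ a b, π a (e b) = e (a * b) := by
  obtain ⟨F, _, _, _, e, he, hd⟩ := (isPosKernel_single (I := Γ)).exists_gram
  obtain ⟨π, hπ⟩ := exists_unitaryRep (Y := Γ) hd (fun a b => a * b) one_mul mul_assoc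
    (fun η a b => by simp [he])
  exact ⟨F, _, _, inferInstance, separableSpace_of_denseRange hd, π, e, he, hπ⟩

theorem eq_conj_of_quadratic_nonneg {a b : ℂ}
    (h : ∀ s : ℂ, 0 ≤ (1 + star s * s + star s * a + s * b).re ∧
      (1 + star s * s + star s * a + s * b).im = 0) : a = star b ∧ ‖b‖ ≤ 1 := by
  have h1 := (h 1).2
  have h2 := (h Complex.I).2
  have hab : a = star b := by
    apply Complex.ext
    · simp at h2 ⊢; linarith
    · simp at h1 ⊢; linarith
  refine ⟨hab, ?_⟩
  have h3 := (h (-star b)).1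
  rw [← sq_le_one_iff₀ (norm_nonneg _), Complex.sq_norm, Complex.normSq_apply]
  simp [hab] at h3
  linarith

/-- The coefficients of a positive trigonometric polynomial with constant term `1` are Hermitian
and bounded by one. -/
theorem coefficients_of_positive {Γ k : Type} [Group Γ] [Countable Γ] [Fintype k] [DecidableEq k]
    (T : Finset Γ) (A : Γ → Matrix k k ℂ) (hA : ∀ α, A α ≠ 0 → α ∈ T) (h1 : A 1 = 1)
    (hpos : ∀ (F : Type) [NormedAddCommGroup F] [InnerProductSpace ℂ F]
      [CompleteSpace F] [TopologicalSpace.SeparableSpace F]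
      (π : Γ →* (F ≃ₗᵢ[ℂ] F)) (ξ : k → F),
      0 ≤ (∑ α ∈ T, ∑ i, ∑ j, A α i j * ⟪ξ i, π α (ξ j)⟫).re ∧
        (∑ α ∈ T, ∑ i, ∑ j, A α i j * ⟪ξ i, π α (ξ j)⟫).im = 0) (α : Γ) :
    A α⁻¹ = (A α)ᴴ ∧ ∀ i j, ‖A α i j‖ ≤ 1 := by
  classical
  by_cases hα : α = 1
  · subst hα
    simp only [inv_one, h1, Matrix.conjTranspose_one, true_and, Matrix.one_apply]
    intro i j
    split_ifs <;> simp
  obtain ⟨F, _, _, _, _, π, e, he, hπ⟩ := exists_regularRep Γ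
  have hsum : ∀ (γ : Γ) (i j : k), (∑ β ∈ T, A β i j * if γ = β then 1 else 0) = A γ i j := by
    intro γ i j
    by_cases hγ : γ ∈ T
    · simp [hγ]
    · have : A γ = 0 := by_contra fun h => hγ (hA γ h)
      simp [hγ, this]
  have key : ∀ i j, ∀ s : ℂ, 0 ≤ (1 + star s * s + star s * A α⁻¹ i j + s * A α j i).re ∧
      (1 + star s * s + star s * A α⁻¹ i j + s * A α j i).im = 0 := by
    intro l m s
    let x : k → ℂ := Pi.single l s
    let y : k → ℂ := Pi.single m 1
    have h := hpos F π fun i => x i • e 1 + y i • e α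
    have e1 : ∀ β i j, ⟪x i • e 1 + y i • e α, π β (x j • e 1 + y j • e α)⟫ =
        (if 1 = β then 1 else 0) * (star (x i) * x j + star (y i) * y j) +
        (if α⁻¹ = β then 1 else 0) * (star (x i) * y j) +
        (if α = β then 1 else 0) * (star (y i) * x j) := by
      intro β i j
      have c1 : (1 = β * α) = (α⁻¹ = β) := by
        rw [inv_eq_iff_eq_inv, eq_inv_iff_mul_eq_one, mul_eq_one_comm]
        exact propext eq_comm
      have c2 : (α = β * α) = (1 = β) := by simp [eq_comm]
      simp only [map_add, map_smul, hπ, inner_add_left, inner_add_right, inner_smul_left,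
        inner_smul_right, he, mul_one, c1, c2, Complex.star_def]
      ring
    have e2 : (∑ β ∈ T, ∑ i, ∑ j, A β i j * ⟪x i • e 1 + y i • e α, π β (x j • e 1 + y j • e α)⟫)
        = 1 + star s * s + star s * A α⁻¹ l m + s * A α m l := by
      simp only [e1]
      rw [Finset.sum_comm]
      have e3 : ∀ i, (∑ β ∈ T, ∑ j, A β i j *
          ((if 1 = β then 1 else 0) * (star (x i) * x j + star (y i) * y j) +
          (if α⁻¹ = β then 1 else 0) * (star (x i) * y j) +
          (if α = β then 1 else 0) * (star (y i) * x j))) =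
          ∑ j, (A 1 i j * (star (x i) * x j + star (y i) * y j) +
          A α⁻¹ i j * (star (x i) * y j) + A α i j * (star (y i) * x j)) := by
        intro i
        rw [Finset.sum_comm]
        refine Finset.sum_congr rfl fun j _ => ?_
        rw [← hsum 1, ← hsum α⁻¹, ← hsum α]
        simp only [Finset.sum_mul, ← Finset.sum_add_distrib]
        refine Finset.sum_congr rfl fun β _ => by ring
      simp only [e3, h1]
      simp only [Matrix.one_apply, Finset.sum_add_distrib, x, y, Pi.single_apply]
      simp [apply_ite star, ite_mul, mul_ite, mul_add,
        Finset.sum_add_distrib]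
      ring
    rwa [e2] at h
  have h2 := fun i j => eq_conj_of_quadratic_nonneg (key i j)
  exact ⟨Matrix.ext fun i j => (h2 i j).1, fun i j => (h2 j i).2⟩

end Coefficients

section Duality

open scoped ComplexOrder

open scoped MatrixOrder Matrix.Norms.L2Operator in
/-- A Hermitian matrix becomes positive after adding a large multiple of the identity. -/
theorem exists_posSemidef_add {n : Type*} [Fintype n] [DecidableEq n] {H : Matrix n n ℂ}
    (hH : H.IsHermitian) : ∃ c : ℝ, ((c : ℂ) • (1 : Matrix n n ℂ) + H).PosSemidef := by
  have h := Matrix.le_iff.1 (IsSelfAdjoint.neg_algebraMap_norm_le_self (a := H) hH)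
  rw [sub_neg_eq_add, add_comm, Algebra.algebraMap_eq_smul_one] at h
  have h2 : ((‖H‖ : ℝ) : ℂ) • (1 : Matrix n n ℂ) = ‖H‖ • 1 := by
    ext i j
    simp
  exact ⟨‖H‖, h2 ▸ h⟩

/-- If no positive matrix agrees with the Hermitian matrix `A` modulo the kernel of `L`, then a
positive functional vanishing on the kernel of `L` is nonpositive at `A`. -/
theorem exists_positive_functional {n V : Type*} [Fintype n] [DecidableEq n] [Nonempty n]
    [AddCommGroup V] [Module ℂ V] (L : Matrix n n ℂ →ₗ[ℂ] V)
    (hstar : ∀ X, L X = 0 → L Xᴴ = 0) (htr : ∀ X, L X = 0 → X.trace = 0)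
    {A : Matrix n n ℂ} (hA : A.IsHermitian)
    (hno : ¬ ∃ X : Matrix n n ℂ, X.PosSemidef ∧ L X = L A) :
    ∃ μ : Matrix n n ℂ →ₗ[ℂ] ℂ, (∀ X, L X = 0 → μ X = 0) ∧
      (∀ X : Matrix n n ℂ, X.PosSemidef → 0 ≤ (μ X).re) ∧ (∀ X, μ Xᴴ = star (μ X)) ∧ μ 1 = 1 ∧
      (μ A).re ≤ 0 := by
  let C : PointedCone ℝ (Matrix n n ℂ) :=
    { carrier := {X | ∃ P : Matrix n n ℂ, P.PosSemidef ∧ ∃ t : ℝ, 0 ≤ t ∧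
        L (X + Xᴴ) = L P - (t : ℂ) • L A}
      zero_mem' := ⟨0, .zero, 0, le_rfl, by simp⟩
      add_mem' := by
        rintro X Y ⟨P, hP, t, ht, hX⟩ ⟨Q, hQ, r, hr, hY⟩
        refine ⟨P + Q, hP.add hQ, t + r, add_nonneg ht hr, ?_⟩
        have : X + Y + (X + Y)ᴴ = (X + Xᴴ) + (Y + Yᴴ) := by
          rw [Matrix.conjTranspose_add]; abel
        rw [this, map_add, hX, hY, map_add]
        push_cast
        module
      smul_mem' := by
        rintro ⟨c, hc⟩ X ⟨P, hP, t, ht, hX⟩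
        have hc' : (0 : ℂ) ≤ (c : ℂ) := by exact_mod_cast hc
        refine ⟨(c : ℂ) • P, hP.smul hc', c * t, mul_nonneg hc ht, ?_⟩
        have h2 : (⟨c, hc⟩ : {c : ℝ // 0 ≤ c}) • X = (c : ℂ) • X := by
          ext i j
          simp
        have : (c : ℂ) • X + ((c : ℂ) • X)ᴴ = (c : ℂ) • (X + Xᴴ) := by
          rw [Matrix.conjTranspose_smul, smul_add]; simp
        rw [h2, this, map_smul, hX, map_smul]
        push_cast
        module }
  let f : Matrix n n ℂ →ₗ.[ℝ] ℝ := LinearPMap.mkSpanSingleton (1 : Matrix n n ℂ) (1 : ℝ) one_ne_zero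
  have hnonneg : ∀ x : f.domain, (x : Matrix n n ℂ) ∈ C → 0 ≤ f x := by
    rintro ⟨x, hx⟩ hxC
    obtain ⟨c, rfl⟩ := Submodule.mem_span_singleton.1 hx
    have hf : f ⟨c • 1, hx⟩ = c := by
      exact (LinearPMap.mkSpanSingleton'_apply _ _ _ c hx).trans (by simp)
    rw [hf]
    by_contra! hc
    obtain ⟨P, hP, t, ht, h⟩ := hxC
    have h1 : c • (1 : Matrix n n ℂ) + (c • (1 : Matrix n n ℂ))ᴴ = (2 * c : ℂ) • 1 := by
      ext i j
      by_cases hij : i = j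
      · subst hij; simp; ring
      · simp [hij]
    have hQ : (P + (-(2 * c) : ℂ) • 1).PosSemidef := by
      refine hP.add (Matrix.PosSemidef.one.smul ?_)
      have : (0 : ℝ) ≤ -(2 * c) := by linarith
      exact_mod_cast this
    rw [h1] at h
    have hL : L (P + (-(2 * c) : ℂ) • 1) = (t : ℂ) • L A := by
      rw [map_add, neg_smul, map_neg, h]
      abel
    rcases ht.eq_or_lt with rfl | ht
    · have htr0 := htr _ (hL.trans (by simp))
      rw [Matrix.trace_add, Matrix.trace_smul, Matrix.trace_one] at htr0
      have h2 := (Complex.le_def.1 hP.trace_nonneg).1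
      have h3 := congrArg Complex.re htr0
      have h4 : (0 : ℝ) < Fintype.card n := by exact_mod_cast Fintype.card_pos
      simp at h3 h2
      nlinarith
    · refine hno ⟨((t⁻¹ : ℝ) : ℂ) • (P + (-(2 * c) : ℂ) • 1), hQ.smul ?_, ?_⟩
      · exact_mod_cast (inv_pos.2 ht).le
      · rw [map_smul, hL, smul_smul]
        norm_cast
        rw [inv_mul_cancel₀ ht.ne', one_smul]
  have hdense : ∀ y, ∃ x : f.domain, (x : Matrix n n ℂ) + y ∈ C := by
    intro y
    have hy : (y + yᴴ).IsHermitian := Matrix.isHermitian_add_transpose_self y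
    obtain ⟨c, hc⟩ := exists_posSemidef_add hy
    refine ⟨⟨(c / 2) • 1, Submodule.mem_span_singleton.2 ⟨_, rfl⟩⟩, _, hc, 0, le_rfl, ?_⟩
    have h1 : (c / 2) • (1 : Matrix n n ℂ) + ((c / 2) • (1 : Matrix n n ℂ))ᴴ = (c : ℂ) • 1 := by
      ext i j
      by_cases hij : i = j
      · subst hij; simp
      · simp [hij]
    rw [← h1, Matrix.conjTranspose_add]
    simp only [Complex.ofReal_zero, zero_smul, sub_zero]
    congr 1
    abel
  obtain ⟨γ, hγf, hγC⟩ := riesz_extension C f hnonneg hdense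
  have hγ1 : γ 1 = 1 := by
    have h1 : (1 : Matrix n n ℂ) ∈ f.domain := Submodule.mem_span_singleton_self _
    have h2 := hγf ⟨1, h1⟩
    rw [h2]
    exact LinearPMap.mkSpanSingleton_apply ℝ ℝ one_ne_zero _
  have hγ0 : ∀ X, L (X + Xᴴ) = 0 → γ X = 0 := by
    intro X hX
    refine le_antisymm ?_ (hγC _ ⟨0, .zero, 0, le_rfl, by simp [hX]⟩)
    have := hγC (-X) ⟨0, .zero, 0, le_rfl, by
      rw [Matrix.conjTranspose_neg, ← neg_add, map_neg, hX]; simp⟩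
    rw [map_neg] at this
    linarith
  have hμ : ∀ X, Module.Dual.extendRCLike (𝕜 := ℂ) γ X =
      (γ X : ℂ) - Complex.I * γ (Complex.I • X) :=
    fun X => rfl
  have hre : ∀ X, (Module.Dual.extendRCLike (𝕜 := ℂ) γ X).re = γ X := fun X =>
    Module.Dual.re_extendRCLike_apply (𝕜 := ℂ) γ X
  refine ⟨Module.Dual.extendRCLike (𝕜 := ℂ) γ, ?_, ?_, ?_, ?_, ?_⟩
  · intro X hX
    have h1 : γ X = 0 := hγ0 X (by rw [map_add, hX, hstar X hX, add_zero])
    have h2 : γ (Complex.I • X) = 0 := hγ0 _ (by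
      rw [Matrix.conjTranspose_smul, map_add, map_smul, map_smul, hX, hstar X hX]; simp)
    rw [hμ, h1, h2]
    simp
  · intro X hX
    rw [hre]
    refine hγC X ⟨X + X, hX.add hX, 0, le_rfl, ?_⟩
    rw [hX.isHermitian.eq]
    simp
  · intro X
    have h1 : γ (X - Xᴴ) = 0 := hγ0 _ (by simp)
    have h2 : γ (Complex.I • X + Complex.I • Xᴴ) = 0 := hγ0 _ (by
      simp only [Matrix.conjTranspose_add, Matrix.conjTranspose_smul,
        Matrix.conjTranspose_conjTranspose, Complex.star_def, Complex.conj_I]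
      rw [← map_zero L]
      congr 1
      module)
    rw [map_sub, sub_eq_zero] at h1
    rw [map_add, add_eq_zero_iff_eq_neg'] at h2
    rw [hμ, hμ, h1, h2]
    simp
  · have h : γ (Complex.I • 1) = 0 := hγ0 _ (by
      rw [Matrix.conjTranspose_smul, Matrix.conjTranspose_one]; simp)
    rw [hμ, hγ1, h]
    simp
  · rw [hre]
    have := hγC (-A) ⟨0, .zero, 2, by norm_num, by
      rw [Matrix.conjTranspose_neg, hA.eq, map_add, map_neg, map_zero]
      push_cast
      module⟩
    rw [map_neg] at this
    linarith

end Duality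

section GramCoefficients

open scoped ComplexOrder

variable {Γ k : Type} [Group Γ] [DecidableEq Γ]

/-- The coefficients `∑_{β⁻¹ γ = α} X_{β γ}` of the trigonometric polynomial with Gram matrix
`X`. -/
def gramCoeff (T : Finset Γ) : Matrix (T × k) (T × k) ℂ →ₗ[ℂ] (Γ → Matrix k k ℂ) where
  toFun X α := Matrix.of fun i j =>
    ∑ β : T, ∑ γ : T, if (β : Γ)⁻¹ * γ = α then X (β, i) (γ, j) else 0
  map_add' X Y := by
    ext α i j
    simp only [Matrix.of_apply, Matrix.add_apply, Pi.add_apply, ← Finset.sum_add_distrib]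
    refine Finset.sum_congr rfl fun β _ => Finset.sum_congr rfl fun γ _ => ?_
    split_ifs <;> simp
  map_smul' c X := by
    ext α i j
    simp only [Matrix.of_apply, Matrix.smul_apply, Pi.smul_apply, Finset.smul_sum,
      RingHom.id_apply, smul_ite, smul_zero]

theorem gramCoeff_apply (T : Finset Γ) (X : Matrix (T × k) (T × k) ℂ) (α : Γ) (i j : k) :
    gramCoeff T X α i j =
      ∑ β : T, ∑ γ : T, if (β : Γ)⁻¹ * γ = α then X (β, i) (γ, j) else 0 := rfl

theorem inv_mul_eq_comm {Γ : Type*} [Group Γ] (a b c : Γ) : a⁻¹ * b = c ↔ b⁻¹ * a = c⁻¹ := by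
  rw [← _root_.inv_inj (a := a⁻¹ * b)]
  simp

theorem gramCoeff_conjTranspose (T : Finset Γ) (X : Matrix (T × k) (T × k) ℂ) (α : Γ) :
    gramCoeff T Xᴴ α = (gramCoeff T X α⁻¹)ᴴ := by
  ext i j
  rw [Matrix.conjTranspose_apply, gramCoeff_apply, gramCoeff_apply, Finset.sum_comm]
  simp only [star_sum, Matrix.conjTranspose_apply, apply_ite star, star_zero]
  refine Finset.sum_congr rfl fun β _ => Finset.sum_congr rfl fun γ _ => ?_
  simp only [inv_mul_eq_comm (γ : Γ) β]

theorem trace_eq_trace_gramCoeff [Fintype k] (T : Finset Γ) (X : Matrix (T × k) (T × k) ℂ) :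
    X.trace = (gramCoeff T X 1).trace := by
  simp only [Matrix.trace, Matrix.diag_apply, gramCoeff_apply, inv_mul_eq_one, Subtype.coe_inj,
    Finset.sum_ite_eq, Finset.mem_univ, if_true, Fintype.sum_prod_type]
  exact Finset.sum_comm

theorem sum_gramCoeff_mul [Fintype k] (T U : Finset Γ) (hU : ∀ β ∈ T, ∀ γ ∈ T, β⁻¹ * γ ∈ U)
    (X : Matrix (T × k) (T × k) ℂ) (φ : Γ → k → k → ℂ) :
    ∑ α ∈ U, ∑ i, ∑ j, gramCoeff T X α i j * φ α i j =
      ∑ a, ∑ b, X a b * φ ((a.1 : Γ)⁻¹ * b.1) a.2 b.2 := by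
  have h : ∀ i j, ∑ α ∈ U, gramCoeff T X α i j * φ α i j =
      ∑ β : T, ∑ γ : T, X (β, i) (γ, j) * φ ((β : Γ)⁻¹ * γ) i j := by
    intro i j
    simp only [gramCoeff_apply, Finset.sum_mul]
    rw [Finset.sum_comm]
    refine Finset.sum_congr rfl fun β _ => ?_
    rw [Finset.sum_comm]
    refine Finset.sum_congr rfl fun γ _ => ?_
    simp only [ite_mul, zero_mul]
    rw [Finset.sum_ite_eq, if_pos (hU _ β.2 _ γ.2)]
  simp only [Fintype.sum_prod_type]
  rw [Finset.sum_comm, Finset.sum_comm (s := Finset.univ (α := T))]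
  refine Finset.sum_congr rfl fun i _ => ?_
  rw [Finset.sum_comm]
  simp only [h]
  rw [Finset.sum_comm]
  refine Finset.sum_congr rfl fun β _ => Finset.sum_comm

/-- A Hermitian coefficient function supported on quotients of elements of `T` has a Hermitian
Gram matrix. -/
theorem exists_gramCoeff_eq (T : Finset Γ) (A : Γ → Matrix k k ℂ) (hA : ∀ α, A α⁻¹ = (A α)ᴴ)
    (hsupp : ∀ α, A α ≠ 0 → ∃ β ∈ T, ∃ γ ∈ T, β⁻¹ * γ = α) :
    ∃ X : Matrix (T × k) (T × k) ℂ, X.IsHermitian ∧ gramCoeff T X = A := by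
  let N : Γ → ℕ := fun α => ∑ β : T, ∑ γ : T, if (β : Γ)⁻¹ * γ = α then 1 else 0
  have hN : ∀ α, N α⁻¹ = N α := by
    intro α
    simp only [N]
    rw [Finset.sum_comm]
    refine Finset.sum_congr rfl fun β _ => Finset.sum_congr rfl fun γ _ => ?_
    simp only [inv_mul_eq_comm (γ : Γ) β, inv_inv]
  refine ⟨Matrix.of fun a b => (N ((a.1 : Γ)⁻¹ * b.1) : ℂ)⁻¹ * A ((a.1 : Γ)⁻¹ * b.1) a.2 b.2,
    ?_, ?_⟩
  · ext a b
    have h : (b.1 : Γ)⁻¹ * a.1 = ((a.1 : Γ)⁻¹ * b.1)⁻¹ := by simp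
    rw [Matrix.conjTranspose_apply, Matrix.of_apply, Matrix.of_apply, h, hN, hA]
    simp
  · ext α i j
    rw [gramCoeff_apply]
    have h1 : ∀ β γ : T, (if (β : Γ)⁻¹ * γ = α then
        (Matrix.of fun a b : T × k => (N ((a.1 : Γ)⁻¹ * b.1) : ℂ)⁻¹ *
          A ((a.1 : Γ)⁻¹ * b.1) a.2 b.2) (β, i) (γ, j) else 0) =
        ((if (β : Γ)⁻¹ * γ = α then (1 : ℕ) else 0 : ℕ) : ℂ) * ((N α : ℂ)⁻¹ * A α i j) := by
      intro β γ
      split_ifs with h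
      · simp [h]
      · simp
    simp only [h1, ← Finset.sum_mul]
    have h2 : (∑ β : T, ∑ γ : T, ((if (β : Γ)⁻¹ * γ = α then (1 : ℕ) else 0 : ℕ) : ℂ)) = N α := by
      simp only [N]
      push_cast
      rfl
    rw [h2]
    by_cases hα : A α = 0
    · simp [hα]
    · obtain ⟨β, hβ, γ, hγ, h⟩ := hsupp α hα
      have hpos : (N α : ℂ) ≠ 0 := by
        rw [Nat.cast_ne_zero]
        refine (Finset.sum_pos' (fun _ _ => Nat.zero_le _) ⟨⟨β, hβ⟩, Finset.mem_univ _, ?_⟩).ne'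
        exact Finset.sum_pos' (fun _ _ => Nat.zero_le _) ⟨⟨γ, hγ⟩, Finset.mem_univ _, by simp [h]⟩
      rw [mul_inv_cancel_left₀ hpos]

theorem IsPosKernel.smul {I : Type*} {κ : I → I → ℂ} (hκ : IsPosKernel κ) {c : ℝ} (hc : 0 ≤ c) :
    IsPosKernel fun i j => (c : ℂ) * κ i j := by
  refine ⟨fun i j => ?_, fun x => ?_⟩
  · rw [star_mul', hκ.1]
    simp
  · have h : (x.sum fun i a => x.sum fun j b => star a * b * ((c : ℂ) * κ i j)) =
        (c : ℂ) * x.sum fun i a => x.sum fun j b => star a * b * κ i j := by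
      simp only [Finsupp.mul_sum]
      refine Finsupp.sum_congr fun i _ => Finsupp.sum_congr fun j _ => ?_
      ring
    rw [h, Complex.re_ofReal_mul]
    exact mul_nonneg hc (hκ.2 x)

/-- If `A` has no positive Gram matrix over `T`, then it is separated from the polynomials with
positive Gram matrices by a positive kernel. -/
theorem exists_separating_kernel [Fintype k] [DecidableEq k] [Nonempty k]
    (T : Finset Γ) (hT : T.Nonempty)
    (A : Γ → Matrix k k ℂ)
    (hA : ∀ α, A α⁻¹ = (A α)ᴴ) (hsupp : ∀ α, A α ≠ 0 → ∃ β ∈ T, ∃ γ ∈ T, β⁻¹ * γ = α)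
    (hno : ¬ ∃ X : Matrix (T × k) (T × k) ℂ, X.PosSemidef ∧ gramCoeff T X = A) :
    ∃ φ : Γ → k → k → ℂ,
      IsPosKernel (fun a b : T × k => φ ((a.1 : Γ)⁻¹ * b.1) a.2 b.2) ∧
      ∑ i, φ 1 i i = 1 ∧ (∀ α i j, ‖φ α i j‖ ≤ 1) ∧
      ∀ U : Finset Γ, (∀ α, A α ≠ 0 → α ∈ U) → (∑ α ∈ U, ∑ i, ∑ j, A α i j * φ α i j).re ≤ 0 := by
  obtain ⟨Z, hZ, rfl⟩ := exists_gramCoeff_eq T A hA hsupp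
  have : Nonempty (T × k) := ⟨⟨⟨_, hT.choose_spec⟩, Classical.arbitrary k⟩⟩
  obtain ⟨μ, hμ0, hμpos, hμstar, hμ1, hμA⟩ := exists_positive_functional (gramCoeff T)
    (fun X hX => by ext1 α; rw [gramCoeff_conjTranspose, hX]; simp)
    (fun X hX => by rw [trace_eq_trace_gramCoeff, hX]; simp) hZ hno
  have hcard : (0 : ℝ) < T.card := by exact_mod_cast hT.card_pos
  obtain ⟨ψ, hψ, hψ0⟩ : ∃ ψ : Γ → k → k → ℂ,
      (∀ a b : T × k, ψ ((a.1 : Γ)⁻¹ * b.1) a.2 b.2 = μ (Matrix.single a b 1)) ∧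
      ∀ α, (¬ ∃ β γ : T, (β : Γ)⁻¹ * γ = α) → ∀ i j, ψ α i j = 0 := by
    classical
    refine ⟨fun α i j => if h : ∃ p : T × T, (p.1 : Γ)⁻¹ * p.2 = α then
      μ (Matrix.single (h.choose.1, i) (h.choose.2, j) 1) else 0, fun a b => ?_, fun α h i j => ?_⟩
    · have h : ∃ p : T × T, (p.1 : Γ)⁻¹ * p.2 = (a.1 : Γ)⁻¹ * b.1 := ⟨(a.1, b.1), rfl⟩
      simp only [dif_pos h]
      rw [← sub_eq_zero, ← map_sub]
      apply hμ0
      rw [map_sub, sub_eq_zero]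
      have key : ∀ (β γ : T) (i j : k), gramCoeff T (Matrix.single (β, i) (γ, j) 1) =
          fun α => if (β : Γ)⁻¹ * γ = α then Matrix.single i j 1 else 0 := by
        intro β γ i j
        ext α i' j'
        rw [gramCoeff_apply, Finset.sum_eq_single β, Finset.sum_eq_single γ]
        · split_ifs <;> simp [Matrix.single_apply]
        · intro γ' _ hγ'
          simp [hγ'.symm]
        · simp
        · intro β' _ hβ'
          simp [hβ'.symm]
        · simp
      have h2 := h.choose_spec
      rw [key, show Matrix.single a b (1 : ℂ) = Matrix.single (a.1, a.2) (b.1, b.2) 1 from rfl, key,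
        h2]
    · exact dif_neg fun ⟨p, hp⟩ => h ⟨p.1, p.2, hp⟩
  have hμsum : ∀ X, μ X = ∑ a, ∑ b, X a b * μ (Matrix.single a b 1) := by
    intro X
    conv_lhs => rw [Matrix.matrix_eq_sum_single X]
    simp only [map_sum]
    refine Finset.sum_congr rfl fun a _ => Finset.sum_congr rfl fun b _ => ?_
    rw [← smul_eq_mul, ← map_smul, Matrix.smul_single, smul_eq_mul, mul_one]
  have hker : IsPosKernel fun a b : T × k => μ (Matrix.single a b 1) := by
    refine ⟨fun a b => ?_, fun x => ?_⟩
    · rw [← hμstar, Matrix.conjTranspose_single, star_one]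
    · have h := hμpos _ (Matrix.posSemidef_vecMulVec_star_self (x : T × k → ℂ))
      rw [hμsum] at h
      rw [Finsupp.sum_fintype _ _ (by simp)]
      have h2 : ∀ a, (x.sum fun b z => star (x a) * z * μ (Matrix.single a b 1)) =
          ∑ b, star (x a) * x b * μ (Matrix.single a b 1) := fun a =>
        Finsupp.sum_fintype _ _ (by simp)
      simp only [h2]
      exact h
  have hφ : IsPosKernel fun a b : T × k => (T.card : ℂ) * ψ ((a.1 : Γ)⁻¹ * b.1) a.2 b.2 := by
    simp only [hψ]
    exact_mod_cast hker.smul hcard.le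
  have htr : ∑ i, (T.card : ℂ) * ψ 1 i i = 1 := by
    rw [← hμ1, hμsum]
    simp only [Matrix.one_apply, ite_mul, one_mul, zero_mul, Finset.sum_ite_eq, Finset.mem_univ,
      if_true, ← hψ, inv_mul_cancel, Fintype.sum_prod_type, Finset.sum_const, Finset.card_univ,
      Fintype.card_coe, nsmul_eq_mul, Finset.mul_sum]
  refine ⟨fun α i j => T.card * ψ α i j, hφ, htr, ?_, ?_⟩
  · obtain ⟨H, _, _, _, e, he, -⟩ := hφ.exists_gram
    obtain ⟨β₀, hβ₀⟩ := hT
    have hdiag : ∀ i, 0 ≤ ((T.card : ℂ) * ψ 1 i i).re := by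
      intro i
      have h := he (⟨β₀, hβ₀⟩, i) (⟨β₀, hβ₀⟩, i)
      simp only [inv_mul_cancel] at h
      rw [← h]
      exact inner_self_nonneg (𝕜 := ℂ)
    have hnorm : ∀ a, ‖e a‖ ≤ 1 := by
      intro a
      have h := he a a
      simp only [inv_mul_cancel] at h
      have h1 : ‖e a‖ ^ 2 = ((T.card : ℂ) * ψ 1 a.2 a.2).re := by
        rw [← h, ← inner_self_eq_norm_sq (𝕜 := ℂ)]
        rfl
      rw [← sq_le_one_iff₀ (norm_nonneg _), h1]
      calc _ ≤ ∑ i, ((T.card : ℂ) * ψ 1 i i).re :=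
            Finset.single_le_sum (f := fun i => ((T.card : ℂ) * ψ 1 i i).re)
              (fun i _ => hdiag i) (Finset.mem_univ a.2)
        _ = 1 := by rw [← Complex.re_sum, htr, Complex.one_re]
    intro α i j
    by_cases hα : ∃ β γ : T, (β : Γ)⁻¹ * γ = α
    · obtain ⟨β, γ, rfl⟩ := hα
      have h := he (β, i) (γ, j)
      simp only at h ⊢
      rw [← h]
      exact (norm_inner_le_norm _ _).trans (mul_le_one₀ (hnorm _) (norm_nonneg _) (hnorm _))
    · simp [hψ0 α hα]
  · intro U hU
    have h1 : ∑ α ∈ U, ∑ i, ∑ j, gramCoeff T Z α i j * (T.card * ψ α i j) =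
        ∑ α ∈ U ∪ Finset.image₂ (fun β γ => β⁻¹ * γ) T T,
          ∑ i, ∑ j, gramCoeff T Z α i j * (T.card * ψ α i j) := by
      refine Finset.sum_subset Finset.subset_union_left fun α _ hα => ?_
      have : gramCoeff T Z α = 0 := by_contra fun h => hα (hU α h)
      simp [this]
    have h3 := sum_gramCoeff_mul T (U ∪ Finset.image₂ (fun β γ => β⁻¹ * γ) T T)
      (fun β hβ γ hγ => Finset.mem_union_right _
      (Finset.mem_image₂_of_mem (f := fun β γ => β⁻¹ * γ) hβ hγ)) Z fun α i j => T.card * ψ α i j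
    have h2 : ∑ a, ∑ b, Z a b * (T.card * ψ ((a.1 : Γ)⁻¹ * b.1) a.2 b.2) =
        ((T.card : ℝ) : ℂ) * μ Z := by
      rw [hμsum, Finset.mul_sum]
      simp only [Finset.mul_sum, hψ]
      refine Finset.sum_congr rfl fun a _ => Finset.sum_congr rfl fun b _ => ?_
      push_cast
      ring
    rw [h1, h3, h2, Complex.re_ofReal_mul]
    exact mul_nonpos_of_nonneg_of_nonpos hcard.le hμA

end GramCoefficients

section Factorization

open scoped ComplexOrder MatrixOrder

/-- A positive Gram matrix yields a Hermitian square. -/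
theorem exists_factorization {Γ : Type} [Group Γ] [DecidableEq Γ] {K : ℕ} (hK : 0 < K)
    (T : Finset Γ) (hT : T.Nonempty) {X : Matrix (T × Fin K) (T × Fin K) ℂ} (hX : X.PosSemidef) :
    ∃ K' : ℕ, 0 < K' ∧ ∃ B : Γ → Matrix (Fin K') (Fin K) ℂ, ∀ α : Γ,
      gramCoeff T X α = ∑ᶠ β ∈ (T : Set Γ), ∑ᶠ γ ∈ {γ : Γ | γ ∈ (T : Set Γ) ∧ β⁻¹ * γ = α},
        (B β)ᴴ * B γ := by
  obtain ⟨C, rfl⟩ := CStarAlgebra.nonneg_iff_eq_star_mul_self.1 (Matrix.nonneg_iff_posSemidef.2 hX)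
  let e := Fintype.equivFin (T × Fin K)
  have : Nonempty (T × Fin K) := ⟨⟨⟨_, hT.choose_spec⟩, ⟨0, hK⟩⟩⟩
  refine ⟨Fintype.card (T × Fin K), Fintype.card_pos, fun β => Matrix.of fun r j =>
    if h : β ∈ T then C (e.symm r) (⟨β, h⟩, j) else 0, fun α => ?_⟩
  have h1 : ∀ β : Γ, {γ : Γ | γ ∈ (T : Set Γ) ∧ β⁻¹ * γ = α} =
      ((T.filter fun γ => β⁻¹ * γ = α : Finset Γ) : Set Γ) := by
    intro β
    ext γ
    simp
  simp only [h1, finsum_mem_coe_finset, Finset.sum_filter]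
  ext i j
  rw [gramCoeff_apply, Matrix.sum_apply, ← Finset.sum_coe_sort T]
  refine Finset.sum_congr rfl fun β _ => ?_
  rw [Matrix.sum_apply, ← Finset.sum_coe_sort T]
  refine Finset.sum_congr rfl fun γ _ => ?_
  by_cases h : (β : Γ)⁻¹ * γ = α
  · rw [if_pos h, if_pos h, Matrix.mul_apply]
    simp only [dif_pos β.2, dif_pos γ.2]
    exact (Equiv.sum_comp e.symm fun r => star (C r (β, i)) * C r (γ, j)).symm
  · rw [if_neg h, if_neg h, Matrix.zero_apply]

end Factorization

section Words

variable {h : ℕ} {Y : Type} [Group Y] (y : Fin h → Y)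

theorem Yle_finite (M : ℕ) : (Yle y M).Finite := by
  refine ((List.finite_length_le (Fin h) M).image fun l => (l.map y).prod).subset ?_
  rintro _ ⟨l, hl, rfl⟩
  exact ⟨l, hl, rfl⟩

theorem Yle_mono {M N : ℕ} (hMN : M ≤ N) : Yle y M ⊆ Yle y N :=
  fun _ ⟨l, hl, hla⟩ => ⟨l, hl.trans hMN, hla⟩

theorem one_mem_Yle (M : ℕ) : 1 ∈ Yle y M := ⟨[], by simp, by simp⟩

/-- Finitely many elements of a group of left fractions have a common denominator. -/
theorem exists_common_denominator
    (hY : ∀ η : Y, ∃ a b : List (Fin h), ((a.map y).prod)⁻¹ * (b.map y).prod = η)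
    (E : Finset Y) : ∃ d : Y, ∃ N : ℕ, ∀ η ∈ E, d * η ∈ Yle y N := by
  classical
  suffices H : ∃ d : List (Fin h), ∃ N : ℕ, ∀ η ∈ E, (d.map y).prod * η ∈ Yle y N from
    let ⟨d, N, hd⟩ := H
    ⟨_, N, hd⟩
  induction E using Finset.induction_on with
  | empty => exact ⟨[], 0, by simp⟩
  | insert η E _ ih =>
    obtain ⟨d, N, hd⟩ := ih
    obtain ⟨a, b, hab⟩ := hY ((d.map y).prod * η)
    refine ⟨a ++ d, max b.length (a.length + N), fun ζ hζ => ?_⟩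
    rw [List.map_append, List.prod_append, mul_assoc]
    rcases Finset.mem_insert.1 hζ with rfl | hζ
    · exact ⟨b, le_max_left _ _, by rw [← hab]; simp⟩
    · obtain ⟨l, hl, hl2⟩ := hd ζ hζ
      exact ⟨a ++ l, by rw [List.length_append]; exact le_max_of_le_right (by omega),
        by rw [List.map_append, List.prod_append, hl2]⟩

theorem countable_of_fractions
    (hY : ∀ η : Y, ∃ a b : List (Fin h), ((a.map y).prod)⁻¹ * (b.map y).prod = η) :
    Countable Y :=
  Function.Surjective.countable
    (f := fun p : List (Fin h) × List (Fin h) => ((p.1.map y).prod)⁻¹ * (p.2.map y).prod)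
    fun η => let ⟨a, b, h⟩ := hY η; ⟨(a, b), h⟩

end Words

section Limit

open Filter Topology

theorem exists_tendsto_of_norm_le_one (p : Ultrafilter ℕ) (f : ℕ → ℂ) (hf : ∀ n, ‖f n‖ ≤ 1) :
    ∃ z, Tendsto f p (𝓝 z) := by
  obtain ⟨z, -, hz⟩ := (isCompact_closedBall (0 : ℂ) 1).ultrafilter_le_nhds (p.map f)
    (by
      rw [le_principal_iff]
      exact Filter.mem_map.2 (Filter.univ_mem' fun n => by simpa using hf n))
  exact ⟨z, hz⟩

/-- A limit of kernels which are eventually Gram kernels on every finite set is positive. -/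
theorem isPosKernel_of_tendsto {I : Type} {p : Filter ℕ} [p.NeBot] {κ : ℕ → I → I → ℂ}
    {κ' : I → I → ℂ} (hκ : ∀ i j, Tendsto (fun n => κ n i j) p (𝓝 (κ' i j)))
    (hfin : ∀ E : Finset I, ∀ᶠ n in p, ∃ (H : Type) (_ : NormedAddCommGroup H)
      (_ : InnerProductSpace ℂ H) (v : I → H), ∀ i ∈ E, ∀ j ∈ E, ⟪v i, v j⟫ = κ n i j) :
    IsPosKernel κ' := by
  classical
  refine ⟨fun i j => ?_, fun x => ?_⟩
  · refine tendsto_nhds_unique_of_eventuallyEq ((continuous_star.tendsto _).comp (hκ i j))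
      (hκ j i) ?_
    filter_upwards [hfin {i, j}] with n hn
    obtain ⟨H, _, _, v, hv⟩ := hn
    have hi : i ∈ ({i, j} : Finset I) := by simp
    have hj : j ∈ ({i, j} : Finset I) := by simp
    simp only [Function.comp]
    rw [← hv i hi j hj, ← hv j hj i hi]
    exact inner_conj_symm _ _
  · have h : Tendsto (fun n => (x.sum fun i a => x.sum fun j b => star a * b * κ n i j).re) p
        (𝓝 (x.sum fun i a => x.sum fun j b => star a * b * κ' i j).re) := by
      refine (Complex.continuous_re.tendsto _).comp ?_
      exact tendsto_finsetSum _ fun i _ => tendsto_finsetSum _ fun j _ => (hκ i j).const_mul _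
    refine ge_of_tendsto h ?_
    filter_upwards [hfin x.support] with n hn
    obtain ⟨H, _, _, v, hv⟩ := hn
    have h2 := (isPosKernel_gram v).2 x
    have h3 : (x.sum fun i a => x.sum fun j b => star a * b * ⟪v i, v j⟫) =
        x.sum fun i a => x.sum fun j b => star a * b * κ n i j :=
      Finset.sum_congr rfl fun i hi => Finset.sum_congr rfl fun j hj =>
        congrArg (star (x i) * x j * ·) (hv i hi j hj)
    rwa [h3] at h2

end Limit

section DegreeBound

open Filter Topology

/-- The degree bound for factorizations, over a suffix-closed finite set `S` of words. -/
theorem exists_degree_bound {G Y J : Type} [Group G] [Countable G] [Group Y] {h K : ℕ} (M : ℕ)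
    (hK : 0 < K) (y : Fin h → Y)
    (hY : ∀ η : Y, ∃ a b : List (Fin h), ((a.map y).prod)⁻¹ * (b.map y).prod = η)
    (s : J → G) (S : Set G) (hSfin : S.Finite) (hS1 : 1 ∈ S) (inv : Prop)
    (hlift : ∀ (L : Type) [Group L] (U : J → L), (inv → ∀ j, U j * U j = 1) →
      ∃ ρ : G →* L, ∀ j, ρ (s j) = U j)
    (hinv : inv → ∀ j, s j * s j = 1)
    (hS : ∀ u ∈ S, ∃ l : List J, (l.map s).prod = u ∧ ∀ l', l' <:+ l → (l'.map s).prod ∈ S)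
    {ε : ℝ} (hε : 0 < ε) :
    ∃ W : ℕ, M ≤ W ∧
      ∀ A : G × Y → Matrix (Fin K) (Fin K) ℂ,
        (∀ α, A α ≠ 0 → α ∈ {α | ∃ u ∈ S, ∃ v ∈ S, u⁻¹ * v = α} ×ˢ (HerYle y M)) →
        A 1 = 1 →
        (∀ (F : Type) [NormedAddCommGroup F] [InnerProductSpace ℂ F]
          [CompleteSpace F] [TopologicalSpace.SeparableSpace F]
          (π : G × Y →* (F ≃ₗᵢ[ℂ] F)) (ξ : Fin K → F),
          ε * (∑ i : Fin K, ‖ξ i‖ ^ 2) ≤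
              (∑ᶠ α ∈ {α | ∃ u ∈ S, ∃ v ∈ S, u⁻¹ * v = α} ×ˢ (HerYle y M),
                ∑ i : Fin K, ∑ j : Fin K, A α i j * ⟪ξ i, π α (ξ j)⟫).re ∧
          (∑ᶠ α ∈ {α | ∃ u ∈ S, ∃ v ∈ S, u⁻¹ * v = α} ×ˢ (HerYle y M),
                ∑ i : Fin K, ∑ j : Fin K, A α i j * ⟪ξ i, π α (ξ j)⟫).im = 0) →
        ∃ K' : ℕ, 0 < K' ∧
          ∃ B : G × Y → Matrix (Fin K') (Fin K) ℂ,
            ∀ α : G × Y,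
              A α = ∑ᶠ β ∈ S ×ˢ (Yle y W),
                      ∑ᶠ γ ∈ {γ : G × Y | γ ∈ S ×ˢ (Yle y W) ∧ β⁻¹ * γ = α},
                        (B β)ᴴ * B γ := by
  classical
  have : Countable Y := countable_of_fractions y hY
  have : Nonempty (Fin K) := ⟨⟨0, hK⟩⟩
  set H : Set G := {α | ∃ u ∈ S, ∃ v ∈ S, u⁻¹ * v = α}
  have hHY : (H ×ˢ HerYle y M).Finite := by
    refine Set.Finite.prod ?_ ?_
    · refine ((hSfin.prod hSfin).image fun p => p.1⁻¹ * p.2).subset ?_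
      rintro _ ⟨u, hu, v, hv, rfl⟩
      exact ⟨(u, v), ⟨hu, hv⟩, rfl⟩
    · refine (((Yle_finite y M).prod (Yle_finite y M)).image fun p => p.1⁻¹ * p.2).subset ?_
      rintro _ ⟨u, hu, v, hv, rfl⟩
      exact ⟨(u, v), ⟨hu, hv⟩, rfl⟩
  let V : Finset (G × Y) := hHY.toFinset
  have hV : ∀ α, α ∈ V ↔ α ∈ H ×ˢ HerYle y M := fun α => hHY.mem_toFinset
  have hsum : ∀ f : G × Y → ℂ, ∑ᶠ α ∈ H ×ˢ HerYle y M, f α = ∑ α ∈ V, f α :=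
    fun f => finsum_mem_eq_finite_toFinset_sum f hHY
  by_contra! hcon
  choose A hA hA1 hpos hnf using fun n => hcon (M + n) (Nat.le_add_right M n)
  simp only [hsum] at hpos
  have hcoef : ∀ n α, A n α⁻¹ = (A n α)ᴴ ∧ ∀ i j, ‖A n α i j‖ ≤ 1 := fun n =>
    coefficients_of_positive V (A n) (fun α hα => (hV α).2 (hA n α hα)) (hA1 n)
      fun F _ _ _ _ π ξ => ⟨le_trans (by positivity) (hpos n F π ξ).1, (hpos n F π ξ).2⟩
  have hT : ∀ n, (S ×ˢ Yle y (M + n)).Finite := fun n => hSfin.prod (Yle_finite y _)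
  have hker : ∀ n, ∃ φ : G × Y → Fin K → Fin K → ℂ,
      IsPosKernel (fun a b : (hT n).toFinset × Fin K =>
        φ ((a.1 : G × Y)⁻¹ * b.1) a.2 b.2) ∧ ∑ i, φ 1 i i = 1 ∧ (∀ α i j, ‖φ α i j‖ ≤ 1) ∧
      ∀ U : Finset (G × Y), (∀ α, A n α ≠ 0 → α ∈ U) →
        (∑ α ∈ U, ∑ i, ∑ j, A n α i j * φ α i j).re ≤ 0 := by
    intro n
    have hTn : (hT n).toFinset.Nonempty :=
      ⟨(1, 1), (hT n).mem_toFinset.2 ⟨hS1, one_mem_Yle y _⟩⟩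
    refine exists_separating_kernel _ hTn (A n) (fun α => (hcoef n α).1) (fun α hα => ?_) ?_
    · obtain ⟨⟨u, hu, v, hv, huv⟩, a, ha, b, hb, hab⟩ := hA n α hα
      exact ⟨(u, a), (hT n).mem_toFinset.2 ⟨hu, Yle_mono y (Nat.le_add_right M n) ha⟩, (v, b),
        (hT n).mem_toFinset.2 ⟨hv, Yle_mono y (Nat.le_add_right M n) hb⟩, Prod.ext huv hab⟩
    · rintro ⟨X, hX, hXA⟩
      obtain ⟨K', hK', B, hB⟩ := exists_factorization hK _ hTn hX
      obtain ⟨α, hα⟩ := hnf n K' hK' B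
      refine hα ?_
      rw [← hXA, hB α]
      simp only [(hT n).coe_toFinset]
  choose φ hφpos hφ1 hφb hφA using hker
  let p : Ultrafilter ℕ := hyperfilter ℕ
  choose a ha using fun α i j =>
    exists_tendsto_of_norm_le_one p (fun n => A n α i j) fun n => (hcoef n α).2 i j
  choose ψ hψ using fun α i j =>
    exists_tendsto_of_norm_le_one p (fun n => φ n α i j) fun n => hφb n α i j
  have hψ1 : ∑ i, ψ 1 i i = 1 := by
    refine tendsto_nhds_unique (tendsto_finsetSum Finset.univ fun i _ => hψ 1 i i) ?_
    simp only [hφ1]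
    exact tendsto_const_nhds
  have hψpos : IsPosKernel fun a b : (S × Y) × Fin K =>
      ψ ((a.1.1 : G)⁻¹ * b.1.1, a.1.2⁻¹ * b.1.2) a.2 b.2 := by
    refine isPosKernel_of_tendsto (p := (p : Filter ℕ)) (fun i j => hψ _ _ _) fun E => ?_
    obtain ⟨d, N, hd⟩ := exists_common_denominator y hY (E.image fun a => a.1.2)
    have hN : ∀ᶠ n in (p : Filter ℕ), N ≤ n :=
      (Nat.hyperfilter_le_atTop) (eventually_ge_atTop N)
    filter_upwards [hN] with n hn
    obtain ⟨L, _, _, _, e, he, -⟩ := (hφpos n).exists_gram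
    refine ⟨L, inferInstance, inferInstance, fun a =>
      if h : ((a.1.1 : G), d * a.1.2) ∈ (hT n).toFinset then e (⟨_, h⟩, a.2) else 0,
      fun i hi j hj => ?_⟩
    have hmem : ∀ i ∈ E, ((i.1.1 : G), d * i.1.2) ∈ (hT n).toFinset := fun i hi =>
      (hT n).mem_toFinset.2 ⟨i.1.1.2, Yle_mono y (hn.trans (Nat.le_add_left n M))
        (hd _ (Finset.mem_image_of_mem _ hi))⟩
    simp only [dif_pos (hmem i hi), dif_pos (hmem j hj), he, Prod.mk_mul_mk, Prod.inv_mk,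
      _root_.mul_inv_rev, mul_assoc, inv_mul_cancel_left]
  obtain ⟨F, _, _, _, _, π, ξ, hπ⟩ :=
    exists_unitary_dilation s S inv hlift hinv hS ψ hψpos
  have hξ : ∑ i, ‖ξ i‖ ^ 2 = 1 := by
    have h1 : ∀ i, ((‖ξ i‖ ^ 2 : ℝ) : ℂ) = ψ 1 i i := by
      intro i
      have := hπ 1 hS1 1 hS1 1 i i
      simp only [inv_one, one_mul] at this
      rw [← Prod.one_eq_mk, map_one] at this
      rw [← this]
      simp [inner_self_eq_norm_sq_to_K]
    have h2 : ((∑ i, ‖ξ i‖ ^ 2 : ℝ) : ℂ) = 1 := by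
      rw [Complex.ofReal_sum, ← hψ1]
      exact Finset.sum_congr rfl fun i _ => h1 i
    exact_mod_cast h2
  have hlow : ∀ n, ε ≤ (∑ α ∈ V, ∑ i, ∑ j, A n α i j * ψ α i j).re := by
    intro n
    have h1 := (hpos n F π ξ).1
    rw [hξ, mul_one] at h1
    refine h1.trans_eq (congrArg Complex.re ?_)
    refine Finset.sum_congr rfl fun α hα => Finset.sum_congr rfl fun i _ =>
      Finset.sum_congr rfl fun j _ => congrArg (A n α i j * ·) ?_
    obtain ⟨⟨u, hu, v, hv, huv⟩, -⟩ := (hV α).1 hα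
    have := hπ u hu v hv α.2 i j
    rwa [huv] at this
  have hup : ∀ n, (∑ α ∈ V, ∑ i, ∑ j, A n α i j * φ n α i j).re ≤ 0 := fun n =>
    hφA n V fun α hα => (hV α).2 (hA n α hα)
  have hlim1 : Tendsto (fun n => (∑ α ∈ V, ∑ i, ∑ j, A n α i j * ψ α i j).re) p
      (𝓝 (∑ α ∈ V, ∑ i, ∑ j, a α i j * ψ α i j).re) :=
    (Complex.continuous_re.tendsto _).comp <| tendsto_finsetSum _ fun α _ =>
      tendsto_finsetSum _ fun i _ => tendsto_finsetSum _ fun j _ => (ha α i j).mul_const _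
  have hlim2 : Tendsto (fun n => (∑ α ∈ V, ∑ i, ∑ j, A n α i j * φ n α i j).re) p
      (𝓝 (∑ α ∈ V, ∑ i, ∑ j, a α i j * ψ α i j).re) :=
    (Complex.continuous_re.tendsto _).comp <| tendsto_finsetSum _ fun α _ =>
      tendsto_finsetSum _ fun i _ => tendsto_finsetSum _ fun j _ => (ha α i j).mul (hψ α i j)
  exact absurd ((ge_of_tendsto' hlim1 hlow).trans (le_of_tendsto' hlim2 hup)) (not_le.2 hε)

end DegreeBound

section FreeMonoid

variable {g : ℕ}

theorem ShortlexLE.length_le {n : ℕ} {a b : List (Fin n)} (h : ShortlexLE a b) :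
    a.length ≤ b.length := by
  rcases h with (h | h) | rfl
  · exact h.le
  · exact h.1.le
  · exact le_rfl

theorem ShortlexLE.of_suffix {n : ℕ} {a b w : List (Fin n)} (h : ShortlexLE b w)
    (hab : a <:+ b) : ShortlexLE a w := by
  rcases hab.length_le.eq_or_lt with hlen | hlen
  · rwa [hab.eq_of_length hlen]
  · exact Or.inl (Or.inl (hlen.trans_le h.length_le))

theorem shortlexLE_nil {n : ℕ} (w : List (Fin n)) : ShortlexLE [] w := by
  cases w with
  | nil => exact Or.inr rfl
  | cons i l => exact Or.inl (Or.inl (by simp))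

theorem WleF_finite (w : List (Fin g)) : (WleF w).Finite := by
  refine ((List.finite_length_le (Fin g) w.length).image wordF).subset ?_
  rintro _ ⟨l, hl, rfl⟩
  exact ⟨l, hl.length_le, rfl⟩

end FreeMonoid

section FreeProduct

variable {g : ℕ}

theorem z2of_mul_self (i : Fin g) : z2of i * z2of i = 1 :=
  PresentedGroup.one_of_mem (rels := z2Rels g) (x := FreeGroup.of i * FreeGroup.of i) ⟨i, rfl⟩

theorem exists_hom_z2of (L : Type) [Group L] (U : Fin g → L) (hU : ∀ j, U j * U j = 1) :
    ∃ ρ : Z2Star g →* L, ∀ j, ρ (z2of j) = U j := by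
  have h : ∀ r ∈ z2Rels g, FreeGroup.lift U r = 1 := by
    rintro _ ⟨i, rfl⟩
    simp [hU]
  exact ⟨PresentedGroup.toGroup h, fun j => PresentedGroup.toGroup.of h⟩

/-- Multiplication of a reduced word by a generator on the left. -/
def reducedCons (i : Fin g) : List (Fin g) → List (Fin g)
  | [] => [i]
  | j :: l => if j = i then l else i :: j :: l

theorem isChain_reducedCons (i : Fin g) {l : List (Fin g)} (hl : l.IsChain (· ≠ ·)) :
    (reducedCons i l).IsChain (· ≠ ·) := by
  cases l with
  | nil => simp [reducedCons]
  | cons j l =>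
    rw [reducedCons]
    split_ifs with h
    · exact hl.tail
    · exact List.isChain_cons_cons.2 ⟨Ne.symm h, hl⟩

theorem reducedCons_of_isChain {i : Fin g} {l : List (Fin g)} (hl : (i :: l).IsChain (· ≠ ·)) :
    reducedCons i l = i :: l := by
  cases l with
  | nil => rfl
  | cons j l => exact if_neg (List.isChain_cons_cons.1 hl).1.symm

theorem reducedCons_reducedCons (i : Fin g) {l : List (Fin g)} (hl : l.IsChain (· ≠ ·)) :
    reducedCons i (reducedCons i l) = l := by
  cases l with
  | nil => simp [reducedCons]
  | cons j l =>
    by_cases h : j = i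
    · subst h
      rw [show reducedCons j (j :: l) = l from if_pos rfl, reducedCons_of_isChain hl]
    · rw [show reducedCons i (j :: l) = i :: j :: l from if_neg h]
      exact if_pos rfl

theorem wordZ_cons (i : Fin g) (l : List (Fin g)) : wordZ (i :: l) = z2of i * wordZ l := rfl

theorem wordZ_reducedCons (i : Fin g) (l : List (Fin g)) :
    wordZ (reducedCons i l) = z2of i * wordZ l := by
  cases l with
  | nil => rfl
  | cons j l =>
    rw [reducedCons]
    split_ifs with h
    · rw [h, wordZ_cons, ← mul_assoc, z2of_mul_self, one_mul]
    · rfl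

/-- The generators act by involutions on the set of reduced words. -/
def reducedPerm (i : Fin g) : Equiv.Perm {l : List (Fin g) // l.IsChain (· ≠ ·)} :=
  Function.Involutive.toPerm (fun l => ⟨reducedCons i l.1, isChain_reducedCons i l.2⟩)
    fun l => Subtype.ext (reducedCons_reducedCons i l.2)

theorem wordZ_injOn : Set.InjOn (wordZ (g := g)) {l | l.IsChain (· ≠ ·)} := by
  obtain ⟨ρ, hρ⟩ := exists_hom_z2of (g := g) _ reducedPerm fun j =>
    Equiv.ext fun l => Subtype.ext (reducedCons_reducedCons j l.2)
  have key : ∀ l : List (Fin g), l.IsChain (· ≠ ·) → (ρ (wordZ l) ⟨[], .nil⟩).1 = l := by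
    intro l hl
    induction l with
    | nil => simp [wordZ]
    | cons i l ih =>
      rw [wordZ_cons, map_mul, hρ, Equiv.Perm.mul_apply]
      change reducedCons i (ρ (wordZ l) ⟨[], .nil⟩).1 = _
      rw [ih hl.tail, reducedCons_of_isChain hl]
  intro a ha b hb hab
  rw [← key a ha, ← key b hb, hab]

theorem exists_reduced_word (w : Z2Star g) :
    ∃ l : List (Fin g), l.IsChain (· ≠ ·) ∧ wordZ l = w := by
  have hstep : ∀ (i : Fin g) (v : Z2Star g),
      (∃ l : List (Fin g), l.IsChain (· ≠ ·) ∧ wordZ l = v) →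
        ∃ l : List (Fin g), l.IsChain (· ≠ ·) ∧ wordZ l = z2of i * v := by
    rintro i _ ⟨l, hl, rfl⟩
    exact ⟨_, isChain_reducedCons i hl, wordZ_reducedCons i l⟩
  have hw : w ∈ Subgroup.closure (Set.range (z2of (g := g))) :=
    (PresentedGroup.closure_range_of (z2Rels g)).symm ▸ Subgroup.mem_top w
  induction hw using Subgroup.closure_induction_left with
  | one => exact ⟨[], .nil, rfl⟩
  | mul_left x hx v _ ih =>
    obtain ⟨i, rfl⟩ := hx
    exact hstep i v ih
  | inv_mul_cancel x hx v _ ih =>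
    obtain ⟨i, rfl⟩ := hx
    rw [inv_eq_of_mul_eq_one_left (z2of_mul_self i)]
    exact hstep i v ih

theorem WleZ_finite (w : Z2Star g) : (WleZ w).Finite := by
  obtain ⟨r, hr, rfl⟩ := exists_reduced_word w
  refine ((List.finite_length_le (Fin g) r.length).image wordZ).subset ?_
  rintro _ ⟨la, lb, -, hlb, rfl, hb, h⟩
  refine ⟨la, ?_, rfl⟩
  rw [← wordZ_injOn hlb hr hb]
  exact h.length_le

theorem one_mem_WleZ (w : Z2Star g) : 1 ∈ WleZ w := by
  obtain ⟨r, hr, rfl⟩ := exists_reduced_word w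
  exact ⟨[], r, .nil, hr, rfl, rfl, shortlexLE_nil r⟩

end FreeProduct

/-- Uniform degree bound for the Fejér–Riesz factorization: given the data
`(w, M, K, 𝔜, ε)` there is a single `W ≥ M` such that every normalized,
uniformly `ε`-positive trigonometric polynomial of bidegree at most `(w, M)`
factors as `B*B` with `B` analytic of bidegree at most `(w, W)`.  The first
conjunct treats `𝒲 = ⟨x⟩_g`, the second `𝒲 = ℤ₂^{*g}`. -/
theorem stmt16 :
    (∀ (g h K M : ℕ), 0 < g → 0 < h → 0 < K → 0 < M →
      ∀ (Y : Type) [Group Y], ∀ y : Fin h → Y,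
      (∀ η : Y, ∃ a b : List (Fin h), ((a.map y).prod)⁻¹ * (b.map y).prod = η) →
      ∀ (w : List (Fin g)) (ε : ℝ), 0 < ε →
      ∃ W : ℕ, M ≤ W ∧
        ∀ A : FreeGroup (Fin g) × Y → Matrix (Fin K) (Fin K) ℂ,
          (∀ α, A α ≠ 0 → α ∈ (HerWleF w) ×ˢ (HerYle y M)) →
          A 1 = 1 →
          (∀ (F : Type) [NormedAddCommGroup F] [InnerProductSpace ℂ F]
            [CompleteSpace F] [TopologicalSpace.SeparableSpace F]
            (π : FreeGroup (Fin g) × Y →* (F ≃ₗᵢ[ℂ] F)) (ξ : Fin K → F),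
            ε * (∑ i : Fin K, ‖ξ i‖ ^ 2) ≤
                (∑ᶠ α ∈ (HerWleF w) ×ˢ (HerYle y M),
                  ∑ i : Fin K, ∑ j : Fin K, A α i j * ⟪ξ i, π α (ξ j)⟫).re ∧
            (∑ᶠ α ∈ (HerWleF w) ×ˢ (HerYle y M),
                  ∑ i : Fin K, ∑ j : Fin K, A α i j * ⟪ξ i, π α (ξ j)⟫).im = 0) →
          ∃ K' : ℕ, 0 < K' ∧
            ∃ B : FreeGroup (Fin g) × Y → Matrix (Fin K') (Fin K) ℂ,
              ∀ α : FreeGroup (Fin g) × Y,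
                A α = ∑ᶠ β ∈ (WleF w) ×ˢ (Yle y W),
                        ∑ᶠ γ ∈ {γ : FreeGroup (Fin g) × Y |
                                  γ ∈ (WleF w) ×ˢ (Yle y W) ∧ β⁻¹ * γ = α},
                          (B β)ᴴ * B γ)
    ∧
    (∀ (g h K M : ℕ), 0 < g → 0 < h → 0 < K → 0 < M →
      ∀ (Y : Type) [Group Y], ∀ y : Fin h → Y,
      (∀ η : Y, ∃ a b : List (Fin h), ((a.map y).prod)⁻¹ * (b.map y).prod = η) →
      ∀ (w : Z2Star g) (ε : ℝ), 0 < ε →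
      ∃ W : ℕ, M ≤ W ∧
        ∀ A : Z2Star g × Y → Matrix (Fin K) (Fin K) ℂ,
          (∀ α, A α ≠ 0 → α ∈ (HerWleZ w) ×ˢ (HerYle y M)) →
          A 1 = 1 →
          (∀ (F : Type) [NormedAddCommGroup F] [InnerProductSpace ℂ F]
            [CompleteSpace F] [TopologicalSpace.SeparableSpace F]
            (π : Z2Star g × Y →* (F ≃ₗᵢ[ℂ] F)) (ξ : Fin K → F),
            ε * (∑ i : Fin K, ‖ξ i‖ ^ 2) ≤
                (∑ᶠ α ∈ (HerWleZ w) ×ˢ (HerYle y M),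
                  ∑ i : Fin K, ∑ j : Fin K, A α i j * ⟪ξ i, π α (ξ j)⟫).re ∧
            (∑ᶠ α ∈ (HerWleZ w) ×ˢ (HerYle y M),
                  ∑ i : Fin K, ∑ j : Fin K, A α i j * ⟪ξ i, π α (ξ j)⟫).im = 0) →
          ∃ K' : ℕ, 0 < K' ∧
            ∃ B : Z2Star g × Y → Matrix (Fin K') (Fin K) ℂ,
              ∀ α : Z2Star g × Y,
                A α = ∑ᶠ β ∈ (WleZ w) ×ˢ (Yle y W),
                        ∑ᶠ γ ∈ {γ : Z2Star g × Y |
                                  γ ∈ (WleZ w) ×ˢ (Yle y W) ∧ β⁻¹ * γ = α},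
                          (B β)ᴴ * B γ) := by
  refine ⟨fun g h K M _ _ hK _ Y _ y hY w ε hε => ?_, fun g h K M _ _ hK _ Y _ y hY w ε hε => ?_⟩
  · have : Countable (FreeGroup (Fin g)) := Function.Surjective.countable Quot.mk_surjective
    refine exists_degree_bound M hK y hY FreeGroup.of (WleF w) (WleF_finite w)
      ⟨[], shortlexLE_nil w, rfl⟩ False (fun L _ U _ => ⟨FreeGroup.lift U, fun j => by simp⟩)
      False.elim ?_ hε
    rintro _ ⟨l, hl, rfl⟩
    exact ⟨l, rfl, fun l' hl' => ⟨l', hl.of_suffix hl', rfl⟩⟩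
  · have : Countable (FreeGroup (Fin g)) := Function.Surjective.countable Quot.mk_surjective
    have : Countable (Z2Star g) :=
      Function.Surjective.countable (PresentedGroup.mk_surjective (z2Rels g))
    refine exists_degree_bound M hK y hY z2of (WleZ w) (WleZ_finite w) (one_mem_WleZ w) True
      (fun L _ U hU => exists_hom_z2of L U (hU trivial)) (fun _ => z2of_mul_self) ?_ hε
    rintro _ ⟨la, lb, hla, hlb, rfl, hb, h⟩
    exact ⟨la, rfl, fun l' hl' =>
      ⟨l', lb, hla.suffix hl', hlb, rfl, hb, h.of_suffix hl'⟩⟩
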